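/- arXiv:2102.07609 — 4 statements merged into one kernel-verified Lean document; each statement's English description precedes it below -/
import Mathlib

section
/- Let (M,ρ) be a pseudometric space, X a two-dimensional real Banach space, and F a set-valued mapping assigning to each x ∈ M a nonempty compact convex subset F(x) ⊆ X. Assume the finiteness hypothesis: for every subset M' ⊆ M with at most 4 points there is a selection f : M' → X (f(x) ∈ F(x) for all x ∈ M') with ‖f(x) − f(y)‖ ≤ ρ(x,y) for all x,y ∈ M'. Let λ1 ≥ 1 satisfy the Lipschitz extension property: every map g from any subset M' ⊆ M into X with ‖g(x)−g(y)‖ ≤ ρ(x,y) on M' extends to a map ĝ : M → X with ‖ĝ(x)−ĝ(y)‖ ≤ λ1·ρ(x,y) on M. Let λ2 ≥ 3λ1 and γ ≥ λ2·(3λ2+λ1)²/(λ2−λ1)². Then for every x ∈ M the second balanced refinement F²(x) is nonempty, and d_H(F²(x), F²(y)) ≤ γ·ρ(x,y) for all x,y ∈ M, where d_H is the Hausdorff distance. -/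
open Pointwise Metric

/-- Hausdorff distance between subsets of a normed space, defined via Minkowski
sums with closed balls: `d_H(A,B) = inf {r > 0 : A ⊆ B + r·B_X and B ⊆ A + r·B_X}`. -/
noncomputable def hausDistB {X : Type*} [NormedAddCommGroup X] (A B : Set X) : ℝ :=
  sInf {r : ℝ | 0 < r ∧ A ⊆ B + closedBall (0 : X) r ∧ B ⊆ A + closedBall (0 : X) r}

theorem aux_helly3 {X : Type*} [NormedAddCommGroup X] [NormedSpace ℝ X]
    (hdim : Module.finrank ℝ X = 2) {ι : Type*} (s : ι → Set X)
    (hc : ∀ i, Convex ℝ (s i)) (hk : ∀ i, IsCompact (s i))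
    (h : ∀ i j k, ∃ p, p ∈ s i ∧ p ∈ s j ∧ p ∈ s k) : ∃ p, ∀ i, p ∈ s i := by
  classical
  have hfd : FiniteDimensional ℝ X := Module.finite_of_finrank_pos (by omega)
  have := Convex.helly_theorem_compact' (𝕜 := ℝ) hc hk (by
    intro I hI
    rw [hdim] at hI
    have h4 : I.card = 0 ∨ I.card = 1 ∨ I.card = 2 ∨ I.card = 3 := by omega
    rcases h4 with h4 | h4 | h4 | h4
    · rw [Finset.card_eq_zero] at h4
      subst h4
      exact ⟨0, by simp⟩
    · obtain ⟨a, rfl⟩ := Finset.card_eq_one.1 h4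
      obtain ⟨p, hp, -⟩ := h a a a
      exact ⟨p, by simpa using hp⟩
    · obtain ⟨a, b, -, rfl⟩ := Finset.card_eq_two.1 h4
      obtain ⟨p, hp, hq, -⟩ := h a b b
      exact ⟨p, by simp [hp, hq]⟩
    · obtain ⟨a, b, c, -, -, -, rfl⟩ := Finset.card_eq_three.1 h4
      obtain ⟨p, hp, hq, hr⟩ := h a b c
      exact ⟨p, by simp [hp, hq, hr]⟩)
  obtain ⟨p, hp⟩ := this
  exact ⟨p, fun i => Set.mem_iInter.1 hp i⟩

theorem aux_helly_one {X : Type*} [NormedAddCommGroup X] [NormedSpace ℝ X]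
    (hdim : Module.finrank ℝ X = 2) {ι : Type*} [Nonempty ι] (s : ι → Set X)
    (hc : ∀ i, Convex ℝ (s i)) (hk : ∀ i, IsCompact (s i))
    (h : ∀ i j k, ∃ p, p ∈ s i ∧ p ∈ s j ∧ p ∈ s k)
    (S : Set X) (hSc : Convex ℝ S) (hSk : IsCompact S)
    (hS : ∀ i j, ∃ p, p ∈ S ∧ p ∈ s i ∧ p ∈ s j) : ∃ p, p ∈ S ∧ ∀ i, p ∈ s i := by
  obtain ⟨i0⟩ := ‹Nonempty ι›
  obtain ⟨p, hp⟩ := aux_helly3 hdim (fun o : Option ι => o.elim S s)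
    (by rintro (_ | i) <;> simp [hSc, hc]) (by rintro (_ | i) <;> simp [hSk, hk])
    (by
      have hS0 : ∃ p, p ∈ S := by
        obtain ⟨p, hp, -⟩ := hS i0 i0
        exact ⟨p, hp⟩
      have hS1 : ∀ i, ∃ p, p ∈ S ∧ p ∈ s i := by
        intro i
        obtain ⟨p, hp, hq, -⟩ := hS i i
        exact ⟨p, hp, hq⟩
      rintro (_ | i) (_ | j) (_ | k)
      · simpa using hS0
      · simpa using hS1 k
      · simpa [and_comm] using hS1 j
      · simpa using hS j k
      · simpa [and_comm] using hS1 i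
      · obtain ⟨p, h1, h2, h3⟩ := hS i k
        exact ⟨p, h2, h1, h3⟩
      · obtain ⟨p, h1, h2, h3⟩ := hS i j
        exact ⟨p, h2, h3, h1⟩
      · simpa using h i j k)
  exact ⟨p, hp none, fun i => hp (some i)⟩

theorem aux_helly_two {X : Type*} [NormedAddCommGroup X] [NormedSpace ℝ X]
    (hdim : Module.finrank ℝ X = 2) {ι : Type*} [Nonempty ι] (s : ι → Set X)
    (hc : ∀ i, Convex ℝ (s i)) (hk : ∀ i, IsCompact (s i))
    (h : ∀ i j k, ∃ p, p ∈ s i ∧ p ∈ s j ∧ p ∈ s k)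
    (S : Set X) (hSc : Convex ℝ S) (hSk : IsCompact S)
    (T : Set X) (hTc : Convex ℝ T) (hTk : IsCompact T)
    (hS : ∀ i j, ∃ p, p ∈ S ∧ p ∈ s i ∧ p ∈ s j)
    (hT : ∀ i j, ∃ p, p ∈ T ∧ p ∈ s i ∧ p ∈ s j)
    (hST : ∀ i, ∃ p, p ∈ S ∧ p ∈ T ∧ p ∈ s i) : ∃ p, p ∈ S ∧ p ∈ T ∧ ∀ i, p ∈ s i := by
  obtain ⟨i0⟩ := ‹Nonempty ι›
  have hT0 : ∃ p, p ∈ T := by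
    obtain ⟨p, hp, -⟩ := hT i0 i0
    exact ⟨p, hp⟩
  have hT1 : ∀ i, ∃ p, p ∈ T ∧ p ∈ s i := by
    intro i
    obtain ⟨p, hp, hq, -⟩ := hT i i
    exact ⟨p, hp, hq⟩
  have hST0 : ∃ p, p ∈ S ∧ p ∈ T := by
    obtain ⟨p, hp, hq, -⟩ := hST i0
    exact ⟨p, hp, hq⟩
  obtain ⟨p, hpS, hp⟩ := aux_helly_one hdim (fun o : Option ι => o.elim T s)
    (by rintro (_ | i) <;> simp [hTc, hc]) (by rintro (_ | i) <;> simp [hTk, hk])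
    (by
      rintro (_ | i) (_ | j) (_ | k)
      · simpa using hT0
      · simpa using hT1 k
      · simpa [and_comm] using hT1 j
      · simpa using hT j k
      · simpa [and_comm] using hT1 i
      · obtain ⟨p, h1, h2, h3⟩ := hT i k
        exact ⟨p, h2, h1, h3⟩
      · obtain ⟨p, h1, h2, h3⟩ := hT i j
        exact ⟨p, h2, h3, h1⟩
      · simpa using h i j k) S hSc hSk
    (by
      rintro (_ | i) (_ | j)
      · simpa using hST0
      · simpa using hST j
      · obtain ⟨p, h1, h2, h3⟩ := hST i
        exact ⟨p, h1, h3, h2⟩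
      · simpa using hS i j)
  exact ⟨p, hpS, hp none, fun i => hp (some i)⟩

theorem aux_mem_add {X : Type*} [NormedAddCommGroup X] (S : Set X) (r : ℝ) (a : X) :
    a ∈ S + closedBall (0 : X) r ↔ ∃ c ∈ S, ‖a - c‖ ≤ r := by
  constructor
  · intro h
    obtain ⟨c, hc, b, hb, rfl⟩ := Set.mem_add.1 h
    exact ⟨c, hc, by simpa using hb⟩
  · rintro ⟨c, hc, h⟩
    exact Set.mem_add.2 ⟨c, hc, a - c, by simpa using h, by abel⟩

theorem aux_tri {X : Type*} [NormedAddCommGroup X] {a b c : X} {r s t : ℝ}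
    (h1 : ‖a - b‖ ≤ r) (h2 : ‖b - c‖ ≤ s) (h : r + s ≤ t) : ‖a - c‖ ≤ t :=
  ((norm_sub_le_norm_sub_add_norm_sub a b c).trans (add_le_add h1 h2)).trans h

/-- intersection of a convex set with a ball is stable under enlargement -/
theorem aux_ball {X : Type*} [NormedAddCommGroup X] [NormedSpace ℝ X]
    (C : Set X) (hC : Convex ℝ C) (l1 l2 d s : ℝ) (hl1 : 0 < l1) (hl : l1 < l2) (hd : 0 ≤ d)
    (hs : 0 ≤ s) (a e c0 c : X) (hc0 : c0 ∈ C) (hc0e : ‖c0 - e‖ ≤ l1 * d) (hc : c ∈ C)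
    (hac : ‖a - c‖ ≤ s) (hae : ‖a - e‖ ≤ l2 * d + s) :
    ∃ p ∈ C, ‖p - e‖ ≤ l2 * d ∧ ‖p - a‖ ≤ (3 * l2 + l1) / (l2 - l1) * s := by
  have hce : ‖c - e‖ ≤ l2 * d + 2 * s :=
    aux_tri (r := s) (by rwa [norm_sub_rev]) hae (by linarith)
  have hlp : 0 < l2 - l1 := by linarith
  rcases hs.eq_or_lt with rfl | hs'
  · refine ⟨c, hc, by linarith, ?_⟩
    rw [norm_sub_rev]; simpa using hac
  · have hD : 0 < (l2 - l1) * d + 2 * s := by positivity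
    set t := 2 * s / ((l2 - l1) * d + 2 * s) with ht
    have ht0 : 0 ≤ t := by positivity
    have ht1 : t ≤ 1 := by
      rw [ht, div_le_one hD]
      have : 0 ≤ (l2 - l1) * d := by positivity
      linarith
    have htD : t * ((l2 - l1) * d + 2 * s) = 2 * s := by
      rw [ht]; field_simp
    refine ⟨(1 - t) • c + t • c0, hC hc hc0 (by linarith) ht0 (by ring), ?_, ?_⟩
    · have : (1 - t) • c + t • c0 - e = (1 - t) • (c - e) + t • (c0 - e) := by module
      rw [this]
      calc _ ≤ ‖(1 - t) • (c - e)‖ + ‖t • (c0 - e)‖ := norm_add_le _ _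
        _ = (1 - t) * ‖c - e‖ + t * ‖c0 - e‖ := by
          rw [norm_smul, norm_smul, Real.norm_of_nonneg ht0, Real.norm_of_nonneg (by linarith)]
        _ ≤ (1 - t) * (l2 * d + 2 * s) + t * (l1 * d) := by
          have : 0 ≤ 1 - t := by linarith
          gcongr
        _ = l2 * d := by linear_combination -htD
    · have h1 : ‖c0 - c‖ ≤ (l2 + l1) * d + 2 * s :=
        aux_tri hc0e (s := l2 * d + 2 * s) (by rw [norm_sub_rev]; exact hce) (by linarith)
      have : (1 - t) • c + t • c0 - a = t • (c0 - c) + (c - a) := by module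
      rw [this]
      calc _ ≤ ‖t • (c0 - c)‖ + ‖c - a‖ := norm_add_le _ _
        _ = t * ‖c0 - c‖ + ‖a - c‖ := by
          rw [norm_smul, Real.norm_of_nonneg ht0, norm_sub_rev c a]
        _ ≤ t * ((l2 + l1) * d + 2 * s) + s := by gcongr
        _ ≤ t * ((l2 + l1) / (l2 - l1) * ((l2 - l1) * d + 2 * s)) + s := by
          have h2 : (l2 + l1) / (l2 - l1) * ((l2 - l1) * d + 2 * s)
              = (l2 + l1) * d + (l2 + l1) / (l2 - l1) * (2 * s) := by field_simp
          have h3 : 1 ≤ (l2 + l1) / (l2 - l1) := by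
            rw [one_le_div hlp]; linarith
          have h4 : 1 * (2 * s) ≤ (l2 + l1) / (l2 - l1) * (2 * s) := by gcongr
          rw [h2]
          have h5 : (l2 + l1) * d + 2 * s ≤
              (l2 + l1) * d + (l2 + l1) / (l2 - l1) * (2 * s) := by linarith
          have h6 := mul_le_mul_of_nonneg_left h5 ht0
          linarith
        _ = (l2 + l1) / (l2 - l1) * (t * ((l2 - l1) * d + 2 * s)) + s := by ring
        _ = (3 * l2 + l1) / (l2 - l1) * s := by rw [htD]; field_simp; ring

theorem aux_split {X : Type*} [NormedAddCommGroup X] [NormedSpace ℝ X] (v : X) (s t : ℝ)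
    (hs : 0 ≤ s) (ht : 0 ≤ t) (h : ‖v‖ ≤ s + t) : ∃ w, ‖w‖ ≤ s ∧ ‖v - w‖ ≤ t := by
  obtain ⟨y, h1, h2⟩ := exists_dist_le_le (x := (0 : X)) (z := v) hs ht
    (by rw [dist_zero_left]; linarith)
  exact ⟨y, by simpa using h1, by rwa [dist_comm, dist_eq_norm] at h2⟩

theorem core_two_dimensional_banach
    {M : Type*} (ρ : M → M → ℝ)
    (hρ_refl : ∀ x, ρ x x = 0)
    (hρ_symm : ∀ x y, ρ x y = ρ y x)
    (hρ_tri : ∀ x y z, ρ x z ≤ ρ x y + ρ y z)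
    {X : Type*} [NormedAddCommGroup X] [NormedSpace ℝ X] [CompleteSpace X]
    (hdim : Module.finrank ℝ X = 2)
    (F : M → Set X)
    (hFne : ∀ x, (F x).Nonempty)
    (hFcp : ∀ x, IsCompact (F x))
    (hFcv : ∀ x, Convex ℝ (F x))
    -- finiteness hypothesis: selections on subsets of at most 4 points
    (hfin : ∀ M' : Finset M, M'.card ≤ 4 →
      ∃ f : M → X, (∀ x ∈ M', f x ∈ F x) ∧
        ∀ x ∈ M', ∀ y ∈ M', ‖f x - f y‖ ≤ ρ x y)
    (lam1 lam2 γ : ℝ) (hlam1 : 1 ≤ lam1)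
    -- Lipschitz extension property of `lam1`
    (hext : ∀ (M' : Set M) (g : M → X),
      (∀ x ∈ M', ∀ y ∈ M', ‖g x - g y‖ ≤ ρ x y) →
      ∃ g' : M → X, (∀ x ∈ M', g' x = g x) ∧ ∀ x y, ‖g' x - g' y‖ ≤ lam1 * ρ x y)
    (hlam2 : 3 * lam1 ≤ lam2)
    (hγ : lam2 * (3 * lam2 + lam1) ^ 2 / (lam2 - lam1) ^ 2 ≤ γ)
    -- the first and second balanced refinements of `F`
    (F1 F2 : M → Set X)
    (hF1 : ∀ x, F1 x = ⋂ z, F z + closedBall (0 : X) (lam1 * ρ x z))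
    (hF2 : ∀ x, F2 x = ⋂ z, F1 z + closedBall (0 : X) (lam2 * ρ x z)) :
    (∀ x, (F2 x).Nonempty) ∧ ∀ x y, hausDistB (F2 x) (F2 y) ≤ γ * ρ x y := by
  classical
  have hfd : FiniteDimensional ℝ X := Module.finite_of_finrank_pos (by omega)
  have hprop : ProperSpace X := FiniteDimensional.proper ℝ X
  have hρ0 : ∀ x y, 0 ≤ ρ x y := by
    intro x y
    have := hρ_tri x y x
    rw [hρ_refl, hρ_symm y x] at this
    linarith
  have hl1 : 0 < lam1 := by linarith
  have hl12 : lam1 < lam2 := by linarith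
  have hl2 : 0 < lam2 := by linarith
  -- enlarged sets
  have encv : ∀ (S : Set X) (r : ℝ), Convex ℝ S → Convex ℝ (S + closedBall (0 : X) r) :=
    fun S r h => h.add (convex_closedBall _ _)
  have enck : ∀ (S : Set X) (r : ℝ), IsCompact S → IsCompact (S + closedBall (0 : X) r) :=
    fun S r h => h.add (isCompact_closedBall _ _)
  obtain ⟨A, hA⟩ : ∃ A : M → M → Set X, A = fun z u => F u + closedBall (0 : X) (lam1 * ρ z u) :=
    ⟨_, rfl⟩
  have hAcv : ∀ z u, Convex ℝ (A z u) := fun z u => by rw [hA]; exact encv _ _ (hFcv u)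
  have hAcp : ∀ z u, IsCompact (A z u) := fun z u => by rw [hA]; exact enck _ _ (hFcp u)
  have hAm : ∀ z u a, a ∈ A z u ↔ ∃ c ∈ F u, ‖a - c‖ ≤ lam1 * ρ z u := fun z u a => by
    rw [hA]; exact aux_mem_add _ _ _
  have hF1m : ∀ z a, a ∈ F1 z ↔ ∀ u, a ∈ A z u := fun z a => by
    rw [hF1, hA]; exact Set.mem_iInter
  have hF1cv : ∀ z, Convex ℝ (F1 z) := fun z => by
    have : F1 z = ⋂ u, A z u := by rw [hF1, hA]
    rw [this]; exact convex_iInter (hAcv z)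
  have hF1cp : ∀ z, IsCompact (F1 z) := fun z => by
    have : F1 z = ⋂ u, A z u := by rw [hF1, hA]
    rw [this]
    exact (hAcp z z).of_isClosed_subset (isClosed_iInter fun u => (hAcp z u).isClosed)
      (Set.iInter_subset _ z)
  -- moving between the sets `A z u` and `A v u`
  have hmove : ∀ z v u a, a ∈ A z u → ∃ b ∈ A v u, ‖a - b‖ ≤ lam1 * ρ z v := by
    intro z v u a ha
    obtain ⟨c, hc, hac⟩ := (hAm _ _ _).1 ha
    have h1 : lam1 * ρ z u ≤ lam1 * ρ z v + lam1 * ρ v u := by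
      rw [← mul_add]; exact mul_le_mul_of_nonneg_left (hρ_tri _ _ _) hl1.le
    obtain ⟨w, hw1, hw2⟩ := aux_split (a - c) _ _ (mul_nonneg hl1.le (hρ0 z v))
      (mul_nonneg hl1.le (hρ0 v u)) (hac.trans h1)
    refine ⟨a - w, (hAm _ _ _).2 ⟨c, hc, ?_⟩, ?_⟩
    · have : a - w - c = a - c - w := by abel
      rwa [this]
    · simpa using hw1
  -- four point selections
  have h4 : ∀ u1 u2 u3 u4, ∃ f : M → X, (∀ z, f z ∈ A z u1) ∧ (∀ z, f z ∈ A z u2) ∧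
      (∀ z, f z ∈ A z u3) ∧ (∀ z, f z ∈ A z u4) ∧ ∀ x y, ‖f x - f y‖ ≤ lam1 * ρ x y := by
    intro u1 u2 u3 u4
    obtain ⟨f, hf1, hf2⟩ := hfin {u1, u2, u3, u4} Finset.card_le_four
    obtain ⟨g, hg1, hg2⟩ := hext (({u1, u2, u3, u4} : Finset M) : Set M) f
      (fun x hx y hy => hf2 x (by exact_mod_cast hx) y (by exact_mod_cast hy))
    have key : ∀ u ∈ ({u1, u2, u3, u4} : Finset M), ∀ z, g z ∈ A z u := by
      intro u hu z
      refine (hAm _ _ _).2 ⟨g u, ?_, hg2 z u⟩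
      rw [hg1 u (by exact_mod_cast hu)]
      exact hf1 u hu
    exact ⟨g, key _ (by simp), key _ (by simp), key _ (by simp), key _ (by simp), hg2⟩
  have h3 : ∀ z i j k, ∃ p, p ∈ A z i ∧ p ∈ A z j ∧ p ∈ A z k := by
    intro z i j k
    obtain ⟨f, h1, h2, h3, -⟩ := h4 i j k k
    exact ⟨f z, h1 z, h2 z, h3 z⟩
  -- pairs
  have hpair : ∀ z v, ∃ c ∈ F1 z, ∃ d ∈ F1 v, ‖c - d‖ ≤ lam1 * ρ z v := by
    intro z v
    have : Nonempty M := ⟨z⟩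
    obtain ⟨c, hc1, hc2⟩ := aux_helly_one hdim (A z) (hAcv z) (hAcp z) (h3 z)
      (F1 v + closedBall (0 : X) (lam1 * ρ z v)) (encv _ _ (hF1cv v)) (enck _ _ (hF1cp v)) (by
        intro u u'
        obtain ⟨d, hd1, hd2⟩ := aux_helly_one hdim (A v) (hAcv v) (hAcp v) (h3 v)
          ((A z u ∩ A z u') + closedBall (0 : X) (lam1 * ρ v z))
          (encv _ _ ((hAcv z u).inter (hAcv z u'))) (enck _ _ ((hAcp z u).inter (hAcp z u'))) (by
            intro w w'
            obtain ⟨f, f1, f2, f3, f4, f5⟩ := h4 u u' w w'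
            exact ⟨f v, (aux_mem_add _ _ _).2 ⟨f z, ⟨f1 z, f2 z⟩, f5 v z⟩, f3 v, f4 v⟩)
        obtain ⟨c, ⟨hc, hc'⟩, hdc⟩ := (aux_mem_add _ _ _).1 hd1
        refine ⟨c, (aux_mem_add _ _ _).2 ⟨d, (hF1m _ _).2 hd2, ?_⟩, hc, hc'⟩
        rwa [norm_sub_rev, hρ_symm])
    obtain ⟨d, hd, hcd⟩ := (aux_mem_add _ _ _).1 hc1
    exact ⟨c, (hF1m _ _).2 hc2, d, hd, hcd⟩
  -- sorted triples
  have hsort : ∀ x z1 z2 z3, ρ x z1 ≤ ρ x z2 → ρ x z2 ≤ ρ x z3 →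
      ∃ a, a ∈ F1 z1 + closedBall (0 : X) (lam2 * ρ x z1) ∧
        a ∈ F1 z2 + closedBall (0 : X) (lam2 * ρ x z2) ∧
        a ∈ F1 z3 + closedBall (0 : X) (lam2 * ρ x z3) := by
    intro x z1 z2 z3 h12 h23
    have : Nonempty M := ⟨x⟩
    have d12 : ρ z1 z2 ≤ ρ x z1 + ρ x z2 := by
      have := hρ_tri z1 x z2; rwa [hρ_symm z1 x] at this
    have d13 : ρ z1 z3 ≤ ρ x z1 + ρ x z3 := by
      have := hρ_tri z1 x z3; rwa [hρ_symm z1 x] at this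
    have d23 : ρ z2 z3 ≤ ρ z1 z2 + ρ z1 z3 := by
      have := hρ_tri z2 z1 z3; rwa [hρ_symm z2 z1] at this
    obtain ⟨b, hb1, hb3, hb2⟩ := aux_helly_two hdim (A z2) (hAcv z2) (hAcp z2) (h3 z2)
      (F1 z1 + closedBall (0 : X) (lam1 * ρ z1 z2)) (encv _ _ (hF1cv _)) (enck _ _ (hF1cp _))
      (F1 z3 + closedBall (0 : X) (lam1 * (ρ z1 z2 + ρ z1 z3)))
      (encv _ _ (hF1cv _)) (enck _ _ (hF1cp _))
      (by
        intro i j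
        obtain ⟨c, hc, d, hd, hcd⟩ := hpair z1 z2
        rw [norm_sub_rev] at hcd
        exact ⟨d, (aux_mem_add _ _ _).2 ⟨c, hc, hcd⟩, (hF1m _ _).1 hd i, (hF1m _ _).1 hd j⟩)
      (by
        intro i j
        obtain ⟨d, hd, c, hc, hdc⟩ := hpair z2 z3
        exact ⟨d, (aux_mem_add _ _ _).2 ⟨c, hc, hdc.trans
          (mul_le_mul_of_nonneg_left d23 hl1.le)⟩, (hF1m _ _).1 hd i, (hF1m _ _).1 hd j⟩)
      (by
        intro u
        obtain ⟨c, hc, e, he, hce⟩ := hpair z1 z3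
        obtain ⟨c2, hc2, hcc⟩ := hmove z1 z2 u c ((hF1m _ _).1 hc u)
        rw [norm_sub_rev] at hcc
        exact ⟨c2, (aux_mem_add _ _ _).2 ⟨c, hc, hcc⟩,
          (aux_mem_add _ _ _).2 ⟨e, he, aux_tri hcc hce (by linarith)⟩, hc2⟩)
    obtain ⟨b1, hb1, hbb1⟩ := (aux_mem_add _ _ _).1 hb1
    obtain ⟨b3, hb3, hbb3⟩ := (aux_mem_add _ _ _).1 hb3
    have r1nn := hρ0 x z1
    generalize ρ x z1 = r1 at *
    generalize ρ x z2 = r2 at *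
    generalize ρ x z3 = r3 at *
    have m : ∀ p q : ℝ, p ≤ q → lam1 * p ≤ lam1 * q := fun p q h =>
      mul_le_mul_of_nonneg_left h hl1.le
    have m2 : ∀ p : ℝ, 0 ≤ p → 3 * (lam1 * p) ≤ lam2 * p := fun p h => by
      have := mul_le_mul_of_nonneg_right hlam2 h; linarith
    obtain ⟨w1, hw1, hw1'⟩ := aux_split (b1 - b) (lam1 * (r2 - r1)) (lam1 * (2 * r1))
      (mul_nonneg hl1.le (by linarith)) (mul_nonneg hl1.le (by linarith))
      (by rw [norm_sub_rev]; have := m _ _ d12; linarith)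
    obtain ⟨w3, hw3, hw3'⟩ := aux_split (b3 - b) (lam1 * r1) (lam1 * (r1 + r2 + r3))
      (mul_nonneg hl1.le (by linarith)) (mul_nonneg hl1.le (by linarith))
      (by rw [norm_sub_rev]; have := m _ _ d12; have := m _ _ d13; linarith)
    refine ⟨b + w1 + w3, (aux_mem_add _ _ _).2 ⟨b1, hb1, ?_⟩,
      (aux_mem_add _ _ _).2 ⟨b, (hF1m _ _).2 hb2, ?_⟩, (aux_mem_add _ _ _).2 ⟨b3, hb3, ?_⟩⟩
    · have : b + w1 + w3 - b1 = w3 - (b1 - b - w1) := by abel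
      rw [this]
      have := norm_sub_le w3 (b1 - b - w1)
      have := m2 r1 r1nn
      linarith
    · have : b + w1 + w3 - b = w1 + w3 := by abel
      rw [this]
      have := norm_add_le w1 w3
      have := m2 r2 (by linarith)
      have := m 0 r2 (by linarith)
      linarith
    · have : b + w1 + w3 - b3 = w1 - (b3 - b - w3) := by abel
      rw [this]
      have := norm_sub_le w1 (b3 - b - w3)
      have := m2 r3 (by linarith)
      have := m _ _ h23
      linarith
  obtain ⟨T, hT⟩ : ∃ T : M → M → Set X,
      T = fun x z => F1 z + closedBall (0 : X) (lam2 * ρ x z) := ⟨_, rfl⟩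
  have hTcv : ∀ z u, Convex ℝ (T z u) := fun z u => by rw [hT]; exact encv _ _ (hF1cv u)
  have hTcp : ∀ z u, IsCompact (T z u) := fun z u => by rw [hT]; exact enck _ _ (hF1cp u)
  have hTm : ∀ x z a, a ∈ T x z ↔ ∃ c ∈ F1 z, ‖a - c‖ ≤ lam2 * ρ x z := fun z u a => by
    rw [hT]; exact aux_mem_add _ _ _
  have hF2m : ∀ x a, a ∈ F2 x ↔ ∀ z, a ∈ T x z := fun z a => by
    rw [hF2, hT]; exact Set.mem_iInter
  have hT3 : ∀ x i j k, ∃ p, p ∈ T x i ∧ p ∈ T x j ∧ p ∈ T x k := by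
    have hs : ∀ x z1 z2 z3, ρ x z1 ≤ ρ x z2 → ρ x z2 ≤ ρ x z3 →
        ∃ a, a ∈ T x z1 ∧ a ∈ T x z2 ∧ a ∈ T x z3 := by
      rw [hT]; exact hsort
    intro x i j k
    rcases le_total (ρ x i) (ρ x j) with h1 | h1 <;>
    rcases le_total (ρ x j) (ρ x k) with h2 | h2 <;>
    rcases le_total (ρ x i) (ρ x k) with h5 | h5
    · obtain ⟨a, p, q, r⟩ := hs x i j k h1 h2
      exact ⟨a, p, q, r⟩
    · obtain ⟨a, p, q, r⟩ := hs x i j k h1 h2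
      exact ⟨a, p, q, r⟩
    · obtain ⟨a, p, q, r⟩ := hs x i k j h5 h2
      exact ⟨a, p, r, q⟩
    · obtain ⟨a, p, q, r⟩ := hs x k i j h5 h1
      exact ⟨a, q, r, p⟩
    · obtain ⟨a, p, q, r⟩ := hs x j i k h1 h5
      exact ⟨a, q, p, r⟩
    · obtain ⟨a, p, q, r⟩ := hs x j k i h2 h5
      exact ⟨a, r, p, q⟩
    · obtain ⟨a, p, q, r⟩ := hs x k j i h2 h1
      exact ⟨a, r, q, p⟩
    · obtain ⟨a, p, q, r⟩ := hs x k j i h2 h1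
      exact ⟨a, r, q, p⟩
  -- the Lipschitz inclusion
  have hlip : ∀ x y, F2 x ⊆ F2 y + closedBall (0 : X) (γ * ρ x y) := by
    intro x y a ha
    have : Nonempty M := ⟨x⟩
    have haT := (hF2m _ _).1 ha
    obtain ⟨θ, hθ⟩ : ∃ θ, θ = (3 * lam2 + lam1) / (lam2 - lam1) := ⟨_, rfl⟩
    have hθ1 : 1 ≤ θ := by
      rw [hθ, one_le_div (by linarith)]; linarith
    have hγ' : lam2 * θ ^ 2 ≤ γ := by
      rw [hθ, div_pow, ← mul_div_assoc]; exact hγ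
    obtain ⟨s, hs⟩ : ∃ s, s = lam2 * ρ x y := ⟨_, rfl⟩
    have hs0 : 0 ≤ s := by rw [hs]; exact mul_nonneg hl2.le (hρ0 _ _)
    have hθs : s ≤ θ * s := by nlinarith
    have hθs0 : 0 ≤ θ * s := by linarith
    have hγs : θ * (θ * s) ≤ γ * ρ x y := by
      have := mul_le_mul_of_nonneg_right hγ' (hρ0 x y)
      rw [hs]; linarith
    have hxz : ∀ z, lam2 * ρ x z ≤ lam2 * ρ y z + s := by
      intro z
      have := mul_le_mul_of_nonneg_left (hρ_tri x y z) hl2.le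
      rw [hs]; linarith
    -- the point `a` is near `F1 v` for every `v`
    have hnear : ∀ v, ∃ h ∈ F1 v, ‖a - h‖ ≤ lam2 * ρ y v + s := by
      intro v
      obtain ⟨h, hh, hah⟩ := (hTm _ _ _).1 (haT v)
      exact ⟨h, hh, hah.trans (hxz v)⟩
    obtain ⟨g, hg, hag⟩ := (hTm _ _ _).1 (haT y)
    rw [← hs] at hag
    -- first application of the ball lemma
    have step1 : ∀ u v, ∃ p ∈ A y u, p ∈ T y v ∧ ‖p - a‖ ≤ θ * s := by
      intro u v
      obtain ⟨h, hh, hah⟩ := hnear v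
      obtain ⟨c0, hc0, hc0h⟩ := hmove v y u h ((hF1m _ _).1 hh u)
      rw [norm_sub_rev, hρ_symm] at hc0h
      obtain ⟨p, hp, hpe, hpa⟩ := aux_ball (A y u) (hAcv y u) lam1 lam2 (ρ y v) s hl1 hl12
        (hρ0 _ _) hs0 a h c0 g hc0 hc0h ((hF1m _ _).1 hg u) hag hah
      exact ⟨p, hp, (hTm _ _ _).2 ⟨h, hh, hpe⟩, by rw [hθ]; exact hpa⟩
    -- second application
    have step2 : ∀ z v, ∃ p, p ∈ closedBall a (γ * ρ x y) ∧ p ∈ T y z ∧ p ∈ T y v := by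
      intro z v
      have hr0 : 0 ≤ lam1 * ρ y z := mul_nonneg hl1.le (hρ0 _ _)
      have hr : lam1 * ρ y z ≤ lam2 * ρ y z := mul_le_mul_of_nonneg_right hl12.le (hρ0 _ _)
      obtain ⟨h, hh1, hh2, hh3⟩ := aux_helly_two hdim (A z) (hAcv z) (hAcp z) (h3 z)
        (T y v + closedBall (0 : X) (lam1 * ρ y z)) (encv _ _ (hTcv _ _)) (enck _ _ (hTcp _ _))
        (closedBall a (lam2 * ρ y z + θ * s)) (convex_closedBall _ _) (isCompact_closedBall _ _)
        (by
          intro i j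
          obtain ⟨c, hc, d, hd, hcd⟩ := hpair z v
          have h1 : lam1 * ρ z v ≤ lam1 * ρ y z + lam2 * ρ y v := by
            have h2 := mul_le_mul_of_nonneg_left (hρ_tri z y v) hl1.le
            rw [hρ_symm z y] at h2
            have h5 := mul_le_mul_of_nonneg_right hl12.le (hρ0 y v)
            linarith
          obtain ⟨w, hw, hw'⟩ := aux_split (c - d) _ _ hr0
            (mul_nonneg hl2.le (hρ0 y v)) (hcd.trans h1)
          refine ⟨c, (aux_mem_add _ _ _).2 ⟨c - w, (hTm _ _ _).2 ⟨d, hd, ?_⟩, by simpa using hw⟩,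
            (hF1m _ _).1 hc i, (hF1m _ _).1 hc j⟩
          have : c - w - d = c - d - w := by abel
          rwa [this])
        (by
          intro i j
          obtain ⟨c, hc, hac⟩ := hnear z
          refine ⟨c, ?_, (hF1m _ _).1 hc i, (hF1m _ _).1 hc j⟩
          rw [mem_closedBall, dist_eq_norm, norm_sub_rev]
          linarith)
        (by
          intro u
          obtain ⟨p, hp1, hp2, hp3⟩ := step1 u v
          obtain ⟨q, hq, hpq⟩ := hmove y z u p hp1
          rw [norm_sub_rev] at hpq
          refine ⟨q, (aux_mem_add _ _ _).2 ⟨p, hp2, hpq⟩, ?_, hq⟩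
          rw [mem_closedBall, dist_eq_norm]
          exact aux_tri hpq hp3 (by linarith))
      obtain ⟨c0, hc0, hhc⟩ := (aux_mem_add _ _ _).1 hh1
      rw [norm_sub_rev] at hhc
      rw [mem_closedBall, dist_eq_norm, norm_sub_rev] at hh2
      obtain ⟨k, hk, hak⟩ := hnear v
      obtain ⟨w, hw, hw'⟩ := aux_split (a - k) s (lam2 * ρ y v) hs0
        (mul_nonneg hl2.le (hρ0 y v)) (by linarith)
      have hc : a - w ∈ T y v := (hTm _ _ _).2 ⟨k, hk, by
        have : a - w - k = a - k - w := by abel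
        rwa [this]⟩
      obtain ⟨p, hp, hpe, hpa⟩ := aux_ball (T y v) (hTcv y v) lam1 lam2 (ρ y z) (θ * s) hl1 hl12
        (hρ0 _ _) hθs0 a h c0 (a - w) hc0 hhc hc (by simpa using hw.trans hθs) hh2
      refine ⟨p, ?_, (hTm _ _ _).2 ⟨h, (hF1m _ _).2 hh3, hpe⟩, hp⟩
      rw [mem_closedBall, dist_eq_norm]
      rw [← hθ] at hpa
      exact hpa.trans hγs
    obtain ⟨p, hp1, hp2⟩ := aux_helly_one hdim (T y) (hTcv y) (hTcp y) (hT3 y)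
      (closedBall a (γ * ρ x y)) (convex_closedBall _ _) (isCompact_closedBall _ _) step2
    refine (aux_mem_add _ _ _).2 ⟨p, (hF2m _ _).2 hp2, ?_⟩
    rwa [mem_closedBall, dist_eq_norm, norm_sub_rev] at hp1
  refine ⟨fun x => ?_, fun x y => ?_⟩
  · obtain ⟨p, hp⟩ := aux_helly3 hdim (T x) (hTcv x) (hTcp x) (hT3 x)
    exact ⟨p, (hF2m _ _).2 hp⟩
  · have hγ0 : 0 ≤ γ := le_trans (by positivity) hγ
    have hnn : 0 ≤ γ * ρ x y := mul_nonneg hγ0 (hρ0 _ _)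
    refine le_of_forall_pos_le_add fun ε hε => ?_
    refine csInf_le ⟨0, fun r hr => hr.1.le⟩ ⟨by linarith, ?_, ?_⟩
    · exact (hlip x y).trans (Set.add_subset_add_left (closedBall_subset_closedBall (by linarith)))
    · refine (hlip y x).trans (Set.add_subset_add_left (closedBall_subset_closedBall ?_))
      rw [hρ_symm y x]; linarith
end

section
/- Let (M,ρ) be a pseudometric space, X a two-dimensional real inner product (Euclidean) space, and F a set-valued mapping assigning to each x ∈ M a nonempty compact convex subset F(x) ⊆ X. Assume the finiteness hypothesis: for every subset M' ⊆ M with at most 4 points there is a selection f : M' → X with ‖f(x) − f(y)‖ ≤ ρ(x,y) for all x,y ∈ M'. Let λ1 ≥ 1 satisfy the Lipschitz extension property: every map g from any subset M' ⊆ M into X with ‖g(x)−g(y)‖ ≤ ρ(x,y) on M' extends to ĝ : M → X with ‖ĝ(x)−ĝ(y)‖ ≤ λ1·ρ(x,y) on M. Let λ2 ≥ 3λ1 and γ ≥ λ2·(1 + 2λ2/√(λ2²−λ1²))². Then for every x ∈ M the second balanced refinement F²(x) is nonempty, and d_H(F²(x), F²(y)) ≤ γ·ρ(x,y) for all x,y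 ∈ M. -/
open Pointwise Metric

theorem mem_nb {X : Type*} [NormedAddCommGroup X] {C : Set X} {r : ℝ} {p : X} :
    p ∈ C + closedBall (0 : X) r ↔ ∃ c ∈ C, ‖p - c‖ ≤ r := by
  constructor
  · rintro ⟨c, hc, b, hb, rfl⟩
    refine ⟨c, hc, ?_⟩
    simpa using hb
  · rintro ⟨c, hc, h⟩
    exact ⟨c, hc, p - c, by simpa using h, by simp⟩

theorem finset_three {ι : Type*} [DecidableEq ι] (I : Finset ι) (h : I.card ≤ 3) (hne : I.Nonempty) :
    ∃ i j k, ∀ l ∈ I, l = i ∨ l = j ∨ l = k := by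
  have h0 : 0 < I.card := hne.card_pos
  have : I.card = 1 ∨ I.card = 2 ∨ I.card = 3 := by omega
  rcases this with h | h | h
  · obtain ⟨a, rfl⟩ := Finset.card_eq_one.1 h
    exact ⟨a, a, a, by simp⟩
  · obtain ⟨a, b, -, rfl⟩ := Finset.card_eq_two.1 h
    exact ⟨a, b, b, by simp⟩
  · obtain ⟨a, b, c, -, -, -, rfl⟩ := Finset.card_eq_three.1 h
    exact ⟨a, b, c, by simp⟩

theorem helly_gen {X : Type*} [NormedAddCommGroup X] [InnerProductSpace ℝ X]
    (hdim : Module.finrank ℝ X = 2) {ι : Type*} (S : ι → Set X)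
    (hcv : ∀ i, Convex ℝ (S i)) (hcp : ∀ i, IsCompact (S i))
    (h3 : ∀ i j k, ∃ p, p ∈ S i ∧ p ∈ S j ∧ p ∈ S k) : ∃ p, ∀ i, p ∈ S i := by
  classical
  have : FiniteDimensional ℝ X := FiniteDimensional.of_finrank_pos (by omega)
  have := Convex.helly_theorem_compact' (𝕜 := ℝ) (F := S) hcv hcp (by
    intro I hI
    rw [hdim] at hI
    rcases I.eq_empty_or_nonempty with rfl | hne
    · simp
    obtain ⟨i, j, k, h⟩ := finset_three I hI hne
    obtain ⟨p, h1, h2, h3⟩ := h3 i j k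
    refine ⟨p, ?_⟩
    simp only [Set.mem_iInter]
    intro l hl
    rcases h l hl with rfl | rfl | rfl <;> assumption)
  obtain ⟨p, hp⟩ := this
  exact ⟨p, by simpa using hp⟩

theorem helly_ball {X : Type*} [NormedAddCommGroup X] [InnerProductSpace ℝ X]
    (hdim : Module.finrank ℝ X = 2) {ι : Type*} [Nonempty ι] (S : ι → Set X) (K : Set X)
    (hcv : ∀ i, Convex ℝ (S i)) (hcp : ∀ i, IsCompact (S i))
    (hKv : Convex ℝ K) (hKp : IsCompact K)
    (h3 : ∀ i j k, ∃ p, p ∈ S i ∧ p ∈ S j ∧ p ∈ S k)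
    (h2 : ∀ i j, ∃ p, p ∈ S i ∧ p ∈ S j ∧ p ∈ K) : ∃ p, p ∈ K ∧ ∀ i, p ∈ S i := by
  obtain ⟨p, hp⟩ := helly_gen hdim (fun o : Option ι => o.elim K S)
    (by rintro (_ | i); exacts [hKv, hcv i]) (by rintro (_ | i); exacts [hKp, hcp i])
    (by
      have i0 := Classical.arbitrary ι
      rintro (_ | i) (_ | j) (_ | k) <;> simp only [Option.elim]
      · obtain ⟨p, a, b, c⟩ := h2 i0 i0; exact ⟨p, c, c, c⟩
      · obtain ⟨p, a, b, c⟩ := h2 k k; exact ⟨p, c, c, a⟩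
      · obtain ⟨p, a, b, c⟩ := h2 j j; exact ⟨p, c, a, c⟩
      · obtain ⟨p, a, b, c⟩ := h2 j k; exact ⟨p, c, a, b⟩
      · obtain ⟨p, a, b, c⟩ := h2 i i; exact ⟨p, a, c, c⟩
      · obtain ⟨p, a, b, c⟩ := h2 i k; exact ⟨p, a, c, b⟩
      · obtain ⟨p, a, b, c⟩ := h2 i j; exact ⟨p, a, b, c⟩
      · exact h3 i j k)
  exact ⟨p, hp none, fun i => hp (some i)⟩

theorem helly4 {X : Type*} [NormedAddCommGroup X] [InnerProductSpace ℝ X]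
    (hdim : Module.finrank ℝ X = 2) (A B C D : Set X)
    (hA : Convex ℝ A) (hB : Convex ℝ B) (hC : Convex ℝ C) (hD : Convex ℝ D)
    (h1 : ∃ p, p ∈ A ∧ p ∈ B ∧ p ∈ C) (h2 : ∃ p, p ∈ A ∧ p ∈ B ∧ p ∈ D)
    (h3 : ∃ p, p ∈ A ∧ p ∈ C ∧ p ∈ D) (h4 : ∃ p, p ∈ B ∧ p ∈ C ∧ p ∈ D) :
    ∃ p, p ∈ A ∧ p ∈ B ∧ p ∈ C ∧ p ∈ D := by
  have : FiniteDimensional ℝ X := FiniteDimensional.of_finrank_pos (by omega)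
  have key := Convex.helly_theorem (𝕜 := ℝ) (F := ![A, B, C, D]) (s := Finset.univ)
    (by rw [hdim]; simp)
    (by intro i _; fin_cases i <;> simpa)
    (by
      intro I _ hI
      rw [hdim] at hI
      have : ∀ I : Finset (Fin 4), I.card = 2 + 1 → I = {0, 1, 2} ∨ I = {0, 1, 3} ∨
        I = {0, 2, 3} ∨ I = {1, 2, 3} := by decide
      rcases this I hI with rfl | rfl | rfl | rfl
      · obtain ⟨p, hp⟩ := h1; exact ⟨p, by simpa using hp⟩
      · obtain ⟨p, hp⟩ := h2; exact ⟨p, by simpa using hp⟩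
      · obtain ⟨p, hp⟩ := h3; exact ⟨p, by simpa using hp⟩
      · obtain ⟨p, hp⟩ := h4; exact ⟨p, by simpa using hp⟩)
  obtain ⟨p, hp⟩ := key
  simp only [Set.mem_iInter, Finset.mem_univ, true_imp_iff] at hp
  exact ⟨p, hp 0, hp 1, hp 2, hp 3⟩

theorem lemA {X : Type*} [NormedAddCommGroup X] [InnerProductSpace ℝ X]
    {C : Set X} (hC : Convex ℝ C) {l1 l2 t e : ℝ} (hl1 : 0 < l1) (hl : l1 < l2)
    (ht : 0 ≤ t) (he : 0 ≤ e) {p w y a : X} (hp : p ∈ C) (hpw : ‖p - w‖ ≤ l1 * t)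
    (hy : y ∈ C) (hay : ‖a - y‖ ≤ e) (haw : ‖a - w‖ ≤ l2 * t + e) :
    ∃ z ∈ C, ‖z - w‖ ≤ l2 * t ∧
      ‖a - z‖ ≤ (1 + 2 * l2 / Real.sqrt (l2 ^ 2 - l1 ^ 2)) * e := by
  have hSq : 0 < l2 ^ 2 - l1 ^ 2 := by nlinarith
  set S := Real.sqrt (l2 ^ 2 - l1 ^ 2) with hS
  have hS0 : 0 < S := Real.sqrt_pos.2 hSq
  have hS2 : S ^ 2 = l2 ^ 2 - l1 ^ 2 := Real.sq_sqrt hSq.le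
  have hl2 : 0 < l2 := hl1.trans hl
  have hq : 0 ≤ 2 * l2 / S := by positivity
  have hqe : 0 ≤ 2 * l2 / S * e := by positivity
  rcases ht.eq_or_lt with h0 | ht0
  · subst h0
    have : p = w := by
      rw [mul_zero] at hpw
      exact sub_eq_zero.1 (norm_le_zero_iff.1 hpw)
    subst this
    refine ⟨p, hp, by simp, ?_⟩
    nlinarith
  by_cases hyw : ‖y - w‖ ≤ l2 * t
  · exact ⟨y, hy, hyw, by nlinarith⟩
  push Not at hyw
  have hcont : ContinuousOn (fun s : ℝ => ‖p + s • (y - p) - w‖) (Set.Icc 0 1) := by fun_prop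
  have hiv := intermediate_value_Icc (zero_le_one (α := ℝ)) hcont
  have hm : l2 * t ∈ Set.Icc (‖p + (0:ℝ) • (y - p) - w‖) (‖p + (1:ℝ) • (y - p) - w‖) := by
    constructor
    · simp only [zero_smul, add_zero]; nlinarith
    · simp only [one_smul, add_sub_cancel]; exact hyw.le
  obtain ⟨s, ⟨hs0, hs1⟩, hs⟩ := hiv hm
  simp only at hs
  set z := p + s • (y - p) with hz
  have hzC : z ∈ C := hC.add_smul_sub_mem hp hy ⟨hs0, hs1⟩
  refine ⟨z, hzC, hs.le, ?_⟩
  have hs0' : 0 < s := by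
    rcases hs0.eq_or_lt with h | h
    · exfalso
      rw [← h] at hz
      simp only [zero_smul, add_zero] at hz
      rw [hz] at hs
      nlinarith
    · exact h
  have e1 : p - w = (z - w) - s • (y - p) := by rw [hz]; abel
  have e2 : y - w = (z - w) + (1 - s) • (y - p) := by rw [hz, sub_smul, one_smul]; abel
  have e3 : y - z = (1 - s) • (y - p) := by rw [hz, sub_smul, one_smul]; abel
  have i1 : ‖p - w‖ ^ 2 = (l2 * t) ^ 2 - 2 * (s * inner ℝ (z - w) (y - p)) + (s * ‖y - p‖) ^ 2 := by
    rw [e1, norm_sub_sq_real, hs, inner_smul_right, norm_smul, Real.norm_of_nonneg hs0]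
  have i2 : ‖p - w‖ ^ 2 ≤ (l1 * t) ^ 2 := by gcongr
  have i3 : s * (‖y - p‖ * S * t) ≤ s * inner ℝ (z - w) (y - p) := by
    nlinarith [sq_nonneg (s * ‖y - p‖ - S * t)]
  have i4 : ‖y - p‖ * S * t ≤ inner ℝ (z - w) (y - p) := le_of_mul_le_mul_left i3 hs0'
  have i5 : inner ℝ (z - w) (y - w) ≤ ‖z - w‖ * ‖y - w‖ := real_inner_le_norm _ _
  have i6 : inner ℝ (z - w) (y - w) = (l2 * t) ^ 2 + (1 - s) * inner ℝ (z - w) (y - p) := by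
    rw [e2, inner_add_right, inner_smul_right, real_inner_self_eq_norm_sq, hs]
  have hyw2 : ‖y - w‖ ≤ l2 * t + 2 * e := by
    have : y - w = (a - w) - (a - y) := by abel
    rw [this]
    linarith [norm_sub_le (a - w) (a - y)]
  have hd : ‖y - z‖ = (1 - s) * ‖y - p‖ := by
    rw [e3, norm_smul, Real.norm_of_nonneg (by linarith)]
  have i7 : t * (‖y - z‖ * S) ≤ t * (2 * l2 * e) := by
    rw [hd]
    rw [i6, hs] at i5
    have a1 := mul_le_mul_of_nonneg_left i4 (by linarith : 0 ≤ 1 - s)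
    have a2 := mul_le_mul_of_nonneg_left hyw2 (by nlinarith : 0 ≤ l2 * t)
    nlinarith
  have i8 := le_of_mul_le_mul_left i7 ht0
  have i9 : ‖y - z‖ ≤ 2 * l2 * e / S := (le_div_iff₀ hS0).2 i8
  have : a - z = (a - y) + (y - z) := by abel
  calc ‖a - z‖ ≤ ‖a - y‖ + ‖y - z‖ := by rw [this]; exact norm_add_le _ _
    _ ≤ e + 2 * l2 * e / S := by linarith
    _ = _ := by ring

theorem lemP {X : Type*} [NormedAddCommGroup X] [InnerProductSpace ℝ X]
    (hdim : Module.finrank ℝ X = 2)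
    {C C1 C2 : Set X} (hC : Convex ℝ C) (hC1 : Convex ℝ C1) (hC2 : Convex ℝ C2)
    {l1 l2 t e : ℝ} (hl1 : 0 < l1) (hl : l1 < l2)
    (ht : 0 ≤ t) (he : 0 ≤ e) {a : X}
    (h0 : ∃ p, p ∈ C1 ∧ p ∈ C2 ∧ p ∈ C + closedBall (0 : X) (l1 * t))
    (h1 : ∃ q, q ∈ C1 ∧ q ∈ C2 ∧ ‖a - q‖ ≤ l2 * t + e)
    (h2 : ∃ c, c ∈ C ∧ c ∈ C1 + closedBall (0 : X) (l1 * t) ∧ ‖a - c‖ ≤ e)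
    (h3 : ∃ c, c ∈ C ∧ c ∈ C2 + closedBall (0 : X) (l1 * t) ∧ ‖a - c‖ ≤ e) :
    ∃ z ∈ C, z ∈ (C1 ∩ C2) + closedBall (0 : X) (l2 * t) ∧
      ‖a - z‖ ≤ (1 + 2 * l2 / Real.sqrt (l2 ^ 2 - l1 ^ 2)) * e := by
  have hmem : ∀ q, ‖a - q‖ ≤ l2 * t + e → q ∈ closedBall a (l2 * t + e) := by
    intro q hq; rwa [mem_closedBall, dist_comm, dist_eq_norm]
  have aux : ∀ K : Set X, (∃ c, c ∈ C ∧ c ∈ K + closedBall (0 : X) (l1 * t) ∧ ‖a - c‖ ≤ e) →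
      ∃ p, p ∈ K ∧ p ∈ C + closedBall (0 : X) (l1 * t) ∧ p ∈ closedBall a (l2 * t + e) := by
    rintro K ⟨c, hc, hcK, hac⟩
    obtain ⟨k, hk, hck⟩ := mem_nb.1 hcK
    refine ⟨k, hk, mem_nb.2 ⟨c, hc, by rwa [norm_sub_rev]⟩, hmem _ ?_⟩
    have : a - k = (a - c) + (c - k) := by abel
    rw [this]
    have := norm_add_le (a - c) (c - k)
    nlinarith
  obtain ⟨w, w1, w2, w3, w4⟩ := helly4 hdim C1 C2 (C + closedBall (0 : X) (l1 * t))
    (closedBall a (l2 * t + e)) hC1 hC2 (hC.add (convex_closedBall _ _)) (convex_closedBall _ _)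
    h0 (by obtain ⟨q, a1, a2, a3⟩ := h1; exact ⟨q, a1, a2, hmem q a3⟩) (aux _ h2) (aux _ h3)
  obtain ⟨p, hp, hwp⟩ := mem_nb.1 w3
  obtain ⟨c, hc, -, hac⟩ := h2
  rw [mem_closedBall, dist_comm, dist_eq_norm] at w4
  obtain ⟨z, hz, hzw, haz⟩ := lemA hC hl1 hl ht he hp (by rwa [norm_sub_rev]) hc hac w4
  exact ⟨z, hz, mem_nb.2 ⟨w, ⟨w1, w2⟩, hzw⟩, haz⟩

theorem nb_tri {X : Type*} [NormedAddCommGroup X] {C : Set X} {r s r' : ℝ} {p q : X}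
    (hp : p ∈ C + closedBall (0 : X) r) (hq : ‖q - p‖ ≤ s) (h : s + r ≤ r') :
    q ∈ C + closedBall (0 : X) r' := by
  obtain ⟨c, hc, hpc⟩ := mem_nb.1 hp
  refine mem_nb.2 ⟨c, hc, ?_⟩
  have : q - c = (q - p) + (p - c) := by abel
  rw [this]
  linarith [norm_add_le (q - p) (p - c)]

/-- shrink: a point of a large neighbourhood is close to a point of a smaller one. -/
theorem nb_split {X : Type*} [NormedAddCommGroup X] [NormedSpace ℝ X] [ProperSpace X] {C : Set X} {r s R : ℝ}
    {p : X} (hr : 0 ≤ r) (hs : 0 ≤ s)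
    (hp : p ∈ C + closedBall (0 : X) R) (h : R ≤ r + s) :
    ∃ q, q ∈ C + closedBall (0 : X) r ∧ ‖p - q‖ ≤ s := by
  obtain ⟨c, hc, hpc⟩ := mem_nb.1 hp
  have h1 : p - c ∈ closedBall (0 : X) r + closedBall (0 : X) s := by
    rw [closedBall_add_closedBall hr hs]
    simp only [add_zero, mem_closedBall, dist_zero_right]
    linarith
  obtain ⟨b, hb, d, hd, hbd⟩ := h1
  refine ⟨c + b, ⟨c, hc, b, hb, rfl⟩, ?_⟩
  have : p - (c + b) = d := by rw [← sub_sub, ← hbd]; simp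
  rw [this]; simpa using hd

/-- convexity of the distance to a convex set. -/
theorem nb_conv {X : Type*} [NormedAddCommGroup X] [NormedSpace ℝ X] {C : Set X}
    (hC : Convex ℝ C) {r s R t : ℝ} {p q : X}
    (ht0 : 0 ≤ t) (ht1 : t ≤ 1)
    (hp : p ∈ C + closedBall (0 : X) r) (hq : q ∈ C + closedBall (0 : X) s)
    (h : t * r + (1 - t) * s ≤ R) :
    t • p + (1 - t) • q ∈ C + closedBall (0 : X) R := by
  obtain ⟨c, hc, hpc⟩ := mem_nb.1 hp
  obtain ⟨d, hd, hqd⟩ := mem_nb.1 hq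
  refine mem_nb.2 ⟨t • c + (1 - t) • d, hC hc hd ht0 (by linarith) (by ring), ?_⟩
  have : t • p + (1 - t) • q - (t • c + (1 - t) • d) = t • (p - c) + (1 - t) • (q - d) := by
    simp only [smul_sub]; abel
  rw [this]
  have h1 := norm_add_le (t • (p - c)) ((1 - t) • (q - d))
  rw [norm_smul, norm_smul, Real.norm_of_nonneg ht0, Real.norm_of_nonneg (by linarith : 0 ≤ 1 - t)]
    at h1
  have h2 := mul_le_mul_of_nonneg_left hpc ht0
  have h3 := mul_le_mul_of_nonneg_left hqd (by linarith : 0 ≤ 1 - t)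
  linarith

theorem five_num {r1 r2 r3 : ℝ} (h0 : 0 ≤ r1) (h12 : r1 ≤ r2) (h23 : r2 ≤ r3) :
    ∃ t : ℝ, 0 ≤ t ∧ t ≤ 1 ∧ t * (r1 + r2) + (1 - t) * (r1 + r2 + 2 * r3) ≤ 3 * r2 ∧
      t * (r1 + 2 * r2 + r3) + (1 - t) * (r1 + r3) ≤ 3 * r3 := by
  rcases (h0.trans (h12.trans h23)).eq_or_lt with h | h
  · exact ⟨1, by norm_num, le_rfl, by linarith, by linarith⟩
  · have e : r2 / (2 * r3) * (2 * r3) = r2 := by field_simp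
    set u := r2 / (2 * r3) with hu
    have u0 : 0 ≤ u := div_nonneg (by linarith) (by linarith)
    have u1 : u ≤ 1 / 2 := by
      rw [hu, div_le_iff₀ (by linarith)]; linarith
    refine ⟨1 - u, by linarith, by linarith, by nlinarith, ?_⟩
    nlinarith [mul_nonneg (by linarith : 0 ≤ 1 - 2 * u) (by linarith : 0 ≤ 2 - 2 * u)]

theorem core_two_dimensional_euclidean
    {M : Type*} (ρ : M → M → ℝ)
    (hρ_refl : ∀ x, ρ x x = 0)
    (hρ_symm : ∀ x y, ρ x y = ρ y x)
    (hρ_tri : ∀ x y z, ρ x z ≤ ρ x y + ρ y z)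
    {X : Type*} [NormedAddCommGroup X] [InnerProductSpace ℝ X]
    (hdim : Module.finrank ℝ X = 2)
    (F : M → Set X)
    (hFne : ∀ x, (F x).Nonempty)
    (hFcp : ∀ x, IsCompact (F x))
    (hFcv : ∀ x, Convex ℝ (F x))
    -- finiteness hypothesis: selections on subsets of at most 4 points
    (hfin : ∀ M' : Finset M, M'.card ≤ 4 →
      ∃ f : M → X, (∀ x ∈ M', f x ∈ F x) ∧
        ∀ x ∈ M', ∀ y ∈ M', ‖f x - f y‖ ≤ ρ x y)
    (lam1 lam2 γ : ℝ) (hlam1 : 1 ≤ lam1)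
    -- Lipschitz extension property of `lam1`
    (hext : ∀ (M' : Set M) (g : M → X),
      (∀ x ∈ M', ∀ y ∈ M', ‖g x - g y‖ ≤ ρ x y) →
      ∃ g' : M → X, (∀ x ∈ M', g' x = g x) ∧ ∀ x y, ‖g' x - g' y‖ ≤ lam1 * ρ x y)
    (hlam2 : 3 * lam1 ≤ lam2)
    (hγ : lam2 * (1 + 2 * lam2 / Real.sqrt (lam2 ^ 2 - lam1 ^ 2)) ^ 2 ≤ γ)
    -- the first and second balanced refinements of `F`
    (F1 F2 : M → Set X)
    (hF1 : ∀ x, F1 x = ⋂ z, F z + closedBall (0 : X) (lam1 * ρ x z))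
    (hF2 : ∀ x, F2 x = ⋂ z, F1 z + closedBall (0 : X) (lam2 * ρ x z)) :
    (∀ x, (F2 x).Nonempty) ∧ ∀ x y, hausDistB (F2 x) (F2 y) ≤ γ * ρ x y := by
  classical
  have hl1 : 0 < lam1 := by linarith
  have hl : lam1 < lam2 := by linarith
  have hl2 : 0 < lam2 := by linarith
  have hρ0 : ∀ x y, 0 ≤ ρ x y := by
    intro x y
    have := hρ_tri x y x
    rw [hρ_refl, hρ_symm y x] at this
    linarith
  have hFD : FiniteDimensional ℝ X := FiniteDimensional.of_finrank_pos (by omega)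
  have hPS : ProperSpace X := FiniteDimensional.proper ℝ X
  have hsel : ∀ z1 z2 z3 z4 : M, ∃ g : M → X, g z1 ∈ F z1 ∧ g z2 ∈ F z2 ∧ g z3 ∈ F z3 ∧
      g z4 ∈ F z4 ∧ ∀ x y, ‖g x - g y‖ ≤ lam1 * ρ x y := by
    intro z1 z2 z3 z4
    obtain ⟨f, hf, hfL⟩ := hfin {z1, z2, z3, z4} Finset.card_le_four
    obtain ⟨g, hg, hgL⟩ := hext (({z1, z2, z3, z4} : Finset M) : Set M) f
      (fun x hx y hy => hfL x hx y hy)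
    have hh : ∀ z ∈ ({z1, z2, z3, z4} : Finset M), g z ∈ F z := fun z hz => by
      rw [hg z hz]; exact hf z hz
    exact ⟨g, hh _ (by simp), hh _ (by simp), hh _ (by simp), hh _ (by simp), hgL⟩
  obtain ⟨A, hA⟩ : ∃ A : M → M → Set X,
    ∀ u z, A u z = F z + closedBall (0 : X) (lam1 * ρ u z) := ⟨_, fun _ _ => rfl⟩
  have hAcv : ∀ u z, Convex ℝ (A u z) := fun u z => by
    rw [hA]; exact (hFcv z).add (convex_closedBall _ _)
  have hAcp : ∀ u z, IsCompact (A u z) := fun u z => by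
    rw [hA]; exact (hFcp z).add (isCompact_closedBall _ _)
  have gA : ∀ (g : M → X) (z : M), g z ∈ F z → (∀ x y, ‖g x - g y‖ ≤ lam1 * ρ x y) →
      ∀ u, g u ∈ A u z := by
    intro g z hz hg u
    rw [hA]; exact mem_nb.2 ⟨g z, hz, hg u z⟩
  have Amove : ∀ u v z p, p ∈ A v z → ∃ q ∈ A u z, ‖p - q‖ ≤ lam1 * ρ u v := by
    intro u v z p hp
    rw [hA] at hp
    rw [hA]
    refine nb_split (mul_nonneg hl1.le (hρ0 _ _)) (mul_nonneg hl1.le (hρ0 _ _)) hp ?_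
    have := mul_le_mul_of_nonneg_left (hρ_tri v u z) hl1.le
    rw [hρ_symm v u] at this
    linarith
  obtain ⟨H, hH⟩ : ∃ H : M → M → M → Set X, ∀ u z z', H u z z' = A u z ∩ A u z' :=
    ⟨_, fun _ _ _ => rfl⟩
  have hHcv : ∀ u z z', Convex ℝ (H u z z') := fun u z z' => by
    rw [hH]; exact (hAcv _ _).inter (hAcv _ _)
  have hHcp : ∀ u z z', IsCompact (H u z z') := fun u z z' => by
    rw [hH]; exact (hAcp _ _).inter (hAcp _ _)
  have gH : ∀ (g : M → X) (z z' : M), g z ∈ F z → g z' ∈ F z' →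
      (∀ x y, ‖g x - g y‖ ≤ lam1 * ρ x y) →
      ∀ u v, g v ∈ H u z z' + closedBall (0 : X) (lam1 * ρ v u) := by
    intro g z z' hz hz' hg u v
    refine mem_nb.2 ⟨g u, ?_, hg v u⟩
    rw [hH]; exact ⟨gA g z hz hg u, gA g z' hz' hg u⟩
  have step1 : ∀ z1 u2 z2 z2' u3 z3 z3', ∃ p, p ∈ H u2 z2 z2' ∧ p ∈ A u2 z1 ∧
      p ∈ H u3 z3 z3' + closedBall (0 : X) (lam1 * ρ u2 u3) := by
    intro z1 u2 z2 z2' u3 z3 z3'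
    obtain ⟨p, h1, h2, h3, h4⟩ := helly4 hdim (A u2 z2) (A u2 z2') (A u2 z1)
      (H u3 z3 z3' + closedBall (0 : X) (lam1 * ρ u2 u3)) (hAcv _ _) (hAcv _ _) (hAcv _ _)
      ((hHcv _ _ _).add (convex_closedBall _ _))
      (by
        obtain ⟨g, a1, a2, a3, -, hg⟩ := hsel z2 z2' z1 z1
        exact ⟨g u2, gA g _ a1 hg _, gA g _ a2 hg _, gA g _ a3 hg _⟩)
      (by
        obtain ⟨g, a1, a2, a3, a4, hg⟩ := hsel z2 z2' z3 z3'
        exact ⟨g u2, gA g _ a1 hg _, gA g _ a2 hg _, gH g _ _ a3 a4 hg _ _⟩)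
      (by
        obtain ⟨g, a1, a2, a3, a4, hg⟩ := hsel z2 z1 z3 z3'
        exact ⟨g u2, gA g _ a1 hg _, gA g _ a2 hg _, gH g _ _ a3 a4 hg _ _⟩)
      (by
        obtain ⟨g, a1, a2, a3, a4, hg⟩ := hsel z2' z1 z3 z3'
        exact ⟨g u2, gA g _ a1 hg _, gA g _ a2 hg _, gH g _ _ a3 a4 hg _ _⟩)
    exact ⟨p, by rw [hH]; exact ⟨h1, h2⟩, h3, h4⟩
  have htri' : ∀ x u v, lam1 * ρ u v ≤ lam1 * ρ x u + lam1 * ρ x v := by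
    intro x u v
    have := mul_le_mul_of_nonneg_left (hρ_tri u x v) hl1.le
    rw [hρ_symm u x] at this
    linarith
  have hscale : ∀ x u, 3 * (lam1 * ρ x u) ≤ lam2 * ρ x u := by
    intro x u
    have := mul_le_mul_of_nonneg_right hlam2 (hρ0 x u)
    linarith
  have step5a : ∀ x u1 z1 u2 z2 z2' u3 z3 z3', ρ x u1 ≤ ρ x u2 → ρ x u2 ≤ ρ x u3 →
      ∃ q, q ∈ A u1 z1 ∧ q ∈ H u2 z2 z2' + closedBall (0 : X) (lam2 * ρ x u2) ∧
        q ∈ H u3 z3 z3' + closedBall (0 : X) (lam2 * ρ x u3) := by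
    intro x u1 z1 u2 z2 z2' u3 z3 z3' h12 h23
    obtain ⟨p2, a1, a2, a3⟩ := step1 z1 u2 z2 z2' u3 z3 z3'
    obtain ⟨p3, b1, b2, b3⟩ := step1 z1 u3 z3 z3' u2 z2 z2'
    obtain ⟨q2, c1, c2⟩ := Amove u1 u2 z1 p2 a2
    obtain ⟨q3, d1, d2⟩ := Amove u1 u3 z1 p3 b2
    rw [norm_sub_rev] at c2 d2
    obtain ⟨t, t0, t1, e1, e2⟩ := five_num (mul_nonneg hl1.le (hρ0 x u1))
      (mul_le_mul_of_nonneg_left h12 hl1.le) (mul_le_mul_of_nonneg_left h23 hl1.le)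
    have k12 := htri' x u1 u2
    have k13 := htri' x u1 u3
    have k23 := htri' x u2 u3
    have k32 := htri' x u3 u2
    refine ⟨t • q2 + (1 - t) • q3, hAcv _ _ c1 d1 t0 (by linarith) (by ring), ?_, ?_⟩
    · exact nb_conv (hHcv _ _ _) t0 t1
        (mem_nb.2 ⟨p2, a1, c2.trans k12⟩)
        (nb_tri b3 d2 (by linarith)) (e1.trans (hscale _ _))
    · exact nb_conv (hHcv _ _ _) t0 t1
        (nb_tri a3 c2 (by linarith))
        (mem_nb.2 ⟨p3, b1, d2.trans k13⟩) (e2.trans (hscale _ _))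
  have step5 : ∀ x u1 z1 u2 z2 z2' u3 z3 z3', ρ x u1 ≤ ρ x u2 → ρ x u1 ≤ ρ x u3 →
      ∃ q, q ∈ A u1 z1 ∧ q ∈ H u2 z2 z2' + closedBall (0 : X) (lam2 * ρ x u2) ∧
        q ∈ H u3 z3 z3' + closedBall (0 : X) (lam2 * ρ x u3) := by
    intro x u1 z1 u2 z2 z2' u3 z3 z3' h12 h13
    rcases le_total (ρ x u2) (ρ x u3) with h | h
    · exact step5a x u1 z1 u2 z2 z2' u3 z3 z3' h12 h
    · obtain ⟨q, h1, h2, h3⟩ := step5a x u1 z1 u3 z3 z3' u2 z2 z2' h13 h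
      exact ⟨q, h1, h3, h2⟩
  obtain ⟨T, hT⟩ : ∃ T : M → M × M × M → Set X,
    ∀ x i, T x i = H i.1 i.2.1 i.2.2 + closedBall (0 : X) (lam2 * ρ x i.1) :=
    ⟨_, fun _ _ => rfl⟩
  have hTcv : ∀ x i, Convex ℝ (T x i) := fun x i => by
    rw [hT]; exact (hHcv _ _ _).add (convex_closedBall _ _)
  have hTcp : ∀ x i, IsCompact (T x i) := fun x i => by
    rw [hT]; exact (hHcp _ _ _).add (isCompact_closedBall _ _)
  have step6a : ∀ x i j k, ρ x i.1 ≤ ρ x j.1 → ρ x i.1 ≤ ρ x k.1 →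
      ∃ p, p ∈ T x i ∧ p ∈ T x j ∧ p ∈ T x k := by
    rintro x ⟨u1, z1, z1'⟩ ⟨u2, z2, z2'⟩ ⟨u3, z3, z3'⟩ h12 h13
    simp only at h12 h13
    simp only [hT]
    have aux : ∀ u z z', ρ x u1 ≤ ρ x u → ∃ p, p ∈ A u1 z1 ∧ p ∈ A u1 z1' ∧
        p ∈ H u z z' + closedBall (0 : X) (lam2 * ρ x u) := by
      intro u z z' h
      obtain ⟨g, a1, a2, a3, a4, hg⟩ := hsel z1 z1' z z'
      refine ⟨g u1, gA g _ a1 hg _, gA g _ a2 hg _, nb_tri (gH g _ _ a3 a4 hg u u1)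
        (s := 0) (by simp) ?_⟩
      have := htri' x u1 u
      have := hscale x u
      have := mul_le_mul_of_nonneg_left h hl1.le
      have := mul_nonneg hl1.le (hρ0 x u)
      linarith
    obtain ⟨p, h1, h2, h3, h4⟩ := helly4 hdim (A u1 z1) (A u1 z1')
      (H u2 z2 z2' + closedBall (0 : X) (lam2 * ρ x u2))
      (H u3 z3 z3' + closedBall (0 : X) (lam2 * ρ x u3)) (hAcv _ _) (hAcv _ _)
      ((hHcv _ _ _).add (convex_closedBall _ _)) ((hHcv _ _ _).add (convex_closedBall _ _))
      (aux _ _ _ h12) (aux _ _ _ h13)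
      (step5 x u1 z1 u2 z2 z2' u3 z3 z3' h12 h13) (step5 x u1 z1' u2 z2 z2' u3 z3 z3' h12 h13)
    refine ⟨p, mem_nb.2 ⟨p, ?_, ?_⟩, h3, h4⟩
    · rw [hH]; exact ⟨h1, h2⟩
    · simpa using mul_nonneg hl2.le (hρ0 x u1)
  have step6 : ∀ x i j k, ∃ p, p ∈ T x i ∧ p ∈ T x j ∧ p ∈ T x k := by
    intro x i j k
    rcases le_total (ρ x i.1) (ρ x j.1) with h | h
    · rcases le_total (ρ x i.1) (ρ x k.1) with h' | h'
      · exact step6a x i j k h h'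
      · obtain ⟨p, h1, h2, h3⟩ := step6a x k i j h' (h'.trans h)
        exact ⟨p, h2, h3, h1⟩
    · rcases le_total (ρ x j.1) (ρ x k.1) with h' | h'
      · obtain ⟨p, h1, h2, h3⟩ := step6a x j i k h h'
        exact ⟨p, h2, h1, h3⟩
      · obtain ⟨p, h1, h2, h3⟩ := step6a x k i j (h'.trans h) h'
        exact ⟨p, h2, h3, h1⟩
  have hF1A : ∀ u p, p ∈ F1 u ↔ ∀ z, p ∈ A u z := by
    intro u p; rw [hF1]; simp only [Set.mem_iInter, hA]
  have hF2T : ∀ x p, (∀ i, p ∈ T x i) → p ∈ F2 x := by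
    intro x p hp
    rw [hF2, Set.mem_iInter]
    intro u
    have : Nonempty M := ⟨u⟩
    obtain ⟨q, hqK, hq⟩ := helly_ball hdim (fun z => A u z) (closedBall p (lam2 * ρ x u))
      (hAcv u) (hAcp u) (convex_closedBall _ _) (isCompact_closedBall _ _)
      (by
        intro i j k
        obtain ⟨g, a1, a2, a3, -, hg⟩ := hsel i j k k
        exact ⟨g u, gA g _ a1 hg _, gA g _ a2 hg _, gA g _ a3 hg _⟩)
      (by
        intro i j
        have := hp (u, i, j)
        rw [hT] at this
        obtain ⟨c, hc, hpc⟩ := mem_nb.1 this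
        simp only [hH] at hc
        refine ⟨c, hc.1, hc.2, ?_⟩
        rwa [mem_closedBall, dist_comm, dist_eq_norm])
    refine mem_nb.2 ⟨q, (hF1A u q).2 hq, ?_⟩
    rwa [mem_closedBall, dist_comm, dist_eq_norm] at hqK
  have hne : ∀ x, (F2 x).Nonempty := by
    intro x
    obtain ⟨p, hp⟩ := helly_gen hdim (T x) (hTcv x) (hTcp x) (step6 x)
    exact ⟨p, hF2T x p hp⟩
  refine ⟨hne, ?_⟩
  set θ := 1 + 2 * lam2 / Real.sqrt (lam2 ^ 2 - lam1 ^ 2) with hθ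
  have hθ1 : 1 ≤ θ := by
    have : 0 ≤ 2 * lam2 / Real.sqrt (lam2 ^ 2 - lam1 ^ 2) := by positivity
    linarith
  have main : ∀ x y a, a ∈ F2 y → ∃ b ∈ F2 x, ‖a - b‖ ≤ γ * ρ x y := by
    intro x y a ha
    have : Nonempty M := ⟨x⟩
    have haF1 : ∀ u, ∃ h ∈ F1 u, ‖a - h‖ ≤ lam2 * ρ y u := by
      intro u
      rw [hF2, Set.mem_iInter] at ha
      exact mem_nb.1 (ha u)
    have he0 : 0 ≤ lam2 * ρ x y := mul_nonneg hl2.le (hρ0 _ _)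
    obtain ⟨b, hb, hbT⟩ := helly_ball hdim (T x) (closedBall a (γ * ρ x y)) (hTcv x) (hTcp x)
      (convex_closedBall _ _) (isCompact_closedBall _ _) (step6 x) (by
        rintro ⟨u1, z1, z1'⟩ ⟨u2, z2, z2'⟩
        obtain ⟨g, a1, a1', a2, a2', hg⟩ := hsel z1 z1' z2 z2'
        obtain ⟨h0, h0F, ha0⟩ := haF1 x
        rw [hρ_symm y x] at ha0
        have h0A := (hF1A x h0).1 h0F
        have haH : ∀ u z z', ∃ q, q ∈ A u z ∧ q ∈ A u z' ∧
            ‖a - q‖ ≤ lam2 * ρ x u + lam2 * ρ x y := by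
          intro u z z'
          obtain ⟨h, hh, hah⟩ := haF1 u
          have h' := (hF1A u h).1 hh
          refine ⟨h, h' z, h' z', hah.trans ?_⟩
          have := mul_le_mul_of_nonneg_left (hρ_tri y x u) hl2.le
          rw [hρ_symm y x] at this
          linarith
        have Anb : ∀ u z p, p ∈ A x z → p ∈ A u z + closedBall (0 : X) (lam1 * ρ x u) := by
          intro u z p hp
          obtain ⟨q, hq, hpq⟩ := Amove u x z p hp
          rw [hρ_symm u x] at hpq
          exact mem_nb.2 ⟨q, hq, hpq⟩
        have inner1 : ∀ z, g z ∈ F z → ∃ c, c ∈ T x (u2, z2, z2') ∧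
            c ∈ A u1 z + closedBall (0 : X) (lam1 * ρ x u1) ∧ ‖a - c‖ ≤ θ * (lam2 * ρ x y) := by
          intro z hz
          obtain ⟨c, c1, c2, c3⟩ := lemP hdim (a := a)
            (C := A u1 z + closedBall (0 : X) (lam1 * ρ x u1))
            ((hAcv u1 z).add (convex_closedBall _ _)) (hAcv u2 z2) (hAcv u2 z2') hl1 hl
            (hρ0 x u2) he0
            ⟨g u2, gA g _ a2 hg _, gA g _ a2' hg _,
              mem_nb.2 ⟨g x, Anb _ _ _ (gA g _ hz hg _), by rw [hρ_symm x u2]; exact hg u2 x⟩⟩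
            (haH u2 z2 z2')
            ⟨h0, Anb _ _ _ (h0A _), Anb _ _ _ (h0A _), ha0⟩
            ⟨h0, Anb _ _ _ (h0A _), Anb _ _ _ (h0A _), ha0⟩
          refine ⟨c, ?_, c1, c3⟩
          rw [hT]; simp only [hH]; exact c2
        have gT : g x ∈ T x (u2, z2, z2') := by
          rw [hT]
          exact nb_tri (gH g _ _ a2 a2' hg u2 x) (s := 0) (by simp) (by
            have := mul_le_mul_of_nonneg_right hl.le (hρ0 x u2)
            simp only; linarith)
        obtain ⟨c, c1, c2, c3⟩ := lemP hdim (a := a) (C := T x (u2, z2, z2')) (hTcv _ _)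
            (hAcv u1 z1) (hAcv u1 z1') hl1 hl (hρ0 x u1)
            (e := θ * (lam2 * ρ x y)) (mul_nonneg (by linarith) he0)
            ⟨g u1, gA g _ a1 hg _, gA g _ a1' hg _,
              mem_nb.2 ⟨g x, gT, by rw [hρ_symm x u1]; exact hg u1 x⟩⟩
            (by
              obtain ⟨q, q1, q2, q3⟩ := haH u1 z1 z1'
              exact ⟨q, q1, q2, by nlinarith⟩)
            (inner1 z1 a1) (inner1 z1' a1')
        refine ⟨c, ?_, c1, ?_⟩
        · rw [hT]; simp only [hH]; exact c2
        · rw [mem_closedBall, dist_comm, dist_eq_norm]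
          refine c3.trans ?_
          have := mul_le_mul_of_nonneg_right hγ (hρ0 x y)
          rw [← hθ]
          calc θ * (θ * (lam2 * ρ x y)) = lam2 * θ ^ 2 * ρ x y := by ring
            _ ≤ _ := this)
    refine ⟨b, hF2T x b hbT, ?_⟩
    rwa [mem_closedBall, dist_comm, dist_eq_norm] at hb
  intro x y
  refine le_of_forall_pos_le_add ?_
  intro ε hε
  have hγ0 : 0 ≤ γ := le_trans (by positivity) hγ
  have hγρ : 0 ≤ γ * ρ x y := mul_nonneg hγ0 (hρ0 x y)
  refine csInf_le ⟨0, fun r hr => hr.1.le⟩ ⟨by linarith, ?_, ?_⟩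
  · intro a ha
    obtain ⟨b, hb, hab⟩ := main y x a ha
    rw [hρ_symm y x] at hab
    exact mem_nb.2 ⟨b, hb, by linarith⟩
  · intro a ha
    obtain ⟨b, hb, hab⟩ := main x y a ha
    exact mem_nb.2 ⟨b, hb, by linarith⟩
end

section
/- Let E be a Euclidean space (a real inner product space), let M ⊆ E with the Euclidean metric ρ(x,y) = ‖x−y‖_E, and let X be a two-dimensional real inner product space. Let F assign to each x ∈ M a nonempty compact convex subset F(x) ⊆ X, and assume that for every subset M' ⊆ M with at most 4 points there is a selection f : M' → X with ‖f(x) − f(y)‖ ≤ ρ(x,y) for all x,y ∈ M'. Then, with λ1 = 1 and λ2 = 3, the second balanced refinement F²(x) is nonempty for every x ∈ M, and d_H(F²(x), F²(y)) ≤ 25·ρ(x,y) for all x,y ∈ M. -/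
open Pointwise Metric

theorem kz_var {Y ι : Type*} [NormedAddCommGroup Y] [InnerProductSpace ℝ Y] [Fintype ι]
    (c : ι → ℝ) (hc : ∑ i, c i = 1) (v : ι → Y) :
    ∑ i, ∑ j, c i * c j * ‖v i - v j‖ ^ 2 =
      2 * ∑ i, c i * ‖v i‖ ^ 2 - 2 * ‖∑ i, c i • v i‖ ^ 2 := by
  have h1 : ‖∑ i, c i • v i‖ ^ 2 = ∑ i, ∑ j, c i * c j * inner ℝ (v i) (v j) := by
    rw [← real_inner_self_eq_norm_sq, sum_inner]
    refine Finset.sum_congr rfl fun i _ => ?_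
    rw [inner_sum]
    refine Finset.sum_congr rfl fun j _ => ?_
    rw [real_inner_smul_left, real_inner_smul_right]; ring
  have h2 : ∑ i, ∑ j, c i * c j * ‖v i‖ ^ 2 = ∑ i, c i * ‖v i‖ ^ 2 := by
    refine Finset.sum_congr rfl fun i _ => ?_
    rw [← Finset.sum_mul, ← Finset.mul_sum, hc, mul_one]
  have h3 : ∑ i, ∑ j, c i * c j * ‖v j‖ ^ 2 = ∑ i, c i * ‖v i‖ ^ 2 := by
    rw [Finset.sum_comm, ← h2]
    refine Finset.sum_congr rfl fun i _ => Finset.sum_congr rfl fun j _ => by ring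
  rw [h1, two_mul]
  nth_rewrite 1 [← h2]
  rw [← h3, Finset.mul_sum, ← Finset.sum_add_distrib, ← Finset.sum_sub_distrib]
  refine Finset.sum_congr rfl fun i _ => ?_
  rw [Finset.mul_sum, ← Finset.sum_add_distrib, ← Finset.sum_sub_distrib]
  refine Finset.sum_congr rfl fun j _ => ?_
  rw [norm_sub_sq_real]; ring

theorem kz_point {E X ι : Type*} [NormedAddCommGroup E] [InnerProductSpace ℝ E]
    [NormedAddCommGroup X] [InnerProductSpace ℝ X] [Fintype ι]
    (x : ι → E) (f : ι → X) (h : ∀ i j, ‖f i - f j‖ ≤ ‖x i - x j‖) (z : E) :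
    ∃ y : X, ∀ i, ‖y - f i‖ ≤ ‖z - x i‖ := by
  classical
  rcases isEmpty_or_nonempty ι with hE | hN
  · exact ⟨0, fun i => hE.elim i⟩
  let Φ : (ι → ℝ) → ℝ := fun c => ∑ i, c i * (‖f i‖ ^ 2 - ‖x i - z‖ ^ 2) - ‖∑ i, c i • f i‖ ^ 2
  have hcont : Continuous Φ := by fun_prop
  obtain ⟨c, hc, hmax⟩ := (isCompact_stdSimplex ℝ ι).exists_isMaxOn
    ⟨_, single_mem_stdSimplex ℝ hN.some⟩ hcont.continuousOn
  have hneg : Φ c ≤ 0 := by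
    have e1 := kz_var c hc.2 f
    have e2 := kz_var c hc.2 (fun i => x i - z)
    have e3 : ∑ i, ∑ j, c i * c j * ‖f i - f j‖ ^ 2 ≤
        ∑ i, ∑ j, c i * c j * ‖(x i - z) - (x j - z)‖ ^ 2 := by
      refine Finset.sum_le_sum fun i _ => Finset.sum_le_sum fun j _ => ?_
      refine mul_le_mul_of_nonneg_left ?_ (mul_nonneg (hc.1 i) (hc.1 j))
      rw [sub_sub_sub_cancel_right]
      exact pow_le_pow_left₀ (norm_nonneg _) (h i j) 2
    have e4 : 0 ≤ ‖∑ i, c i • (x i - z)‖ ^ 2 := by positivity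
    have e5 : Φ c = ∑ i, c i * ‖f i‖ ^ 2 - ∑ i, c i * ‖x i - z‖ ^ 2 - ‖∑ i, c i • f i‖ ^ 2 := by
      simp only [Φ, mul_sub, Finset.sum_sub_distrib]
    rw [e5]; linarith
  refine ⟨∑ i, c i • f i, fun j => ?_⟩
  set y := ∑ i, c i • f i with hy
  have key : ∀ t : ℝ, 0 < t → t < 1 → (1 - t) * ‖y - f j‖ ^ 2 ≤ ‖x j - z‖ ^ 2 := by
    intro t ht ht1
    have hm : (1 - t) • c + t • (Pi.single j 1 : ι → ℝ) ∈ stdSimplex ℝ ι :=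
      (convex_stdSimplex ℝ ι) hc (single_mem_stdSimplex ℝ j) (by linarith) ht.le (by ring)
    have h1 : Φ ((1 - t) • c + t • (Pi.single j 1 : ι → ℝ)) ≤ Φ c := hmax hm
    have h2 : ∑ i, ((1 - t) • c + t • (Pi.single j 1 : ι → ℝ)) i • f i = (1 - t) • y + t • f j := by
      simp [add_smul, Finset.sum_add_distrib, mul_smul, ← Finset.smul_sum, Pi.single_apply, hy]
    have h3 : ∑ i, ((1 - t) • c + t • (Pi.single j 1 : ι → ℝ)) i * (‖f i‖ ^ 2 - ‖x i - z‖ ^ 2)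
        = (1 - t) * ∑ i, c i * (‖f i‖ ^ 2 - ‖x i - z‖ ^ 2) + t * (‖f j‖ ^ 2 - ‖x j - z‖ ^ 2) := by
      simp [add_mul, Finset.sum_add_distrib, mul_assoc, ← Finset.mul_sum, Pi.single_apply]
    have h4 : ‖(1 - t) • y + t • f j‖ ^ 2 =
        (1 - t) * ‖y‖ ^ 2 + t * ‖f j‖ ^ 2 - t * (1 - t) * ‖y - f j‖ ^ 2 := by
      rw [norm_add_sq_real, norm_sub_sq_real, norm_smul, norm_smul, real_inner_smul_left,
        real_inner_smul_right, mul_pow, mul_pow, Real.norm_eq_abs, Real.norm_eq_abs, sq_abs, sq_abs]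
      ring
    simp only [Φ] at h1 hneg
    rw [h2, h3, h4] at h1
    rw [← hy] at h1 hneg
    set S := ∑ i, c i * (‖f i‖ ^ 2 - ‖x i - z‖ ^ 2)
    have h5 : t * ((1 - t) * ‖y - f j‖ ^ 2) ≤ t * ‖x j - z‖ ^ 2 := by nlinarith
    exact le_of_mul_le_mul_left h5 ht
  have hfin : ‖y - f j‖ ^ 2 ≤ ‖x j - z‖ ^ 2 := by
    by_contra! hlt
    have hpos : 0 < ‖y - f j‖ ^ 2 := lt_of_le_of_lt (by positivity) hlt
    set P := ‖y - f j‖ ^ 2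
    set Q := ‖x j - z‖ ^ 2
    have hQ : 0 ≤ Q := by positivity
    have := key ((P - Q) / (2 * P)) (by apply div_pos <;> linarith)
      (by rw [div_lt_one (by linarith)]; linarith)
    have e : (1 - (P - Q) / (2 * P)) * P = P - (P - Q) / 2 := by field_simp
    rw [e] at this; linarith
  rw [norm_sub_rev z]
  exact le_of_sq_le_sq hfin (norm_nonneg _)

theorem kz_ext {E X : Type*} [NormedAddCommGroup E] [InnerProductSpace ℝ E]
    [NormedAddCommGroup X] [InnerProductSpace ℝ X]
    (S : Finset E) (f : E → X) (h : ∀ x ∈ S, ∀ y ∈ S, ‖f x - f y‖ ≤ ‖x - y‖) (z : E) :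
    ∃ g : E → X, (∀ x ∈ S, g x = f x) ∧
      ∀ x ∈ insert z (S : Set E), ∀ y ∈ insert z (S : Set E), ‖g x - g y‖ ≤ ‖x - y‖ := by
  classical
  by_cases hz : z ∈ S
  · refine ⟨f, fun _ _ => rfl, ?_⟩
    rw [Set.insert_eq_of_mem (by simpa using hz)]
    simpa using h
  obtain ⟨y, hy⟩ := kz_point (fun i : S => (i : E)) (fun i : S => f i)
    (fun i j => h i i.2 j j.2) z
  have hne : ∀ x ∈ S, x ≠ z := fun x hx e => hz (e ▸ hx)
  refine ⟨fun x => if x = z then y else f x, fun x hx => if_neg (hne x hx), ?_⟩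
  rintro a (rfl | ha) b (rfl | hb)
  · simp
  · simpa [hne b hb] using hy ⟨b, hb⟩
  · rw [norm_sub_rev, norm_sub_rev a]
    simpa [hne a ha] using hy ⟨a, ha⟩
  · simpa [hne a ha, hne b hb] using h a ha b hb

/-- move along a segment -/
theorem kz_move {X : Type*} [NormedAddCommGroup X] [InnerProductSpace ℝ X]
    (q s g : X) (r e : ℝ) (hr : 0 ≤ r) (he : 0 ≤ e) (hq : ‖q - g‖ ≤ 3 * r + e)
    (hs : ‖s - g‖ ≤ r) : ∃ b ∈ segment ℝ q s, ‖b - g‖ ≤ 3 * r ∧ ‖b - q‖ ≤ 9 / 8 * e := by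
  by_cases h0 : ‖q - g‖ ≤ 3 * r
  · exact ⟨q, left_mem_segment _ _ _, h0, by simp; positivity⟩
  push Not at h0
  have hc : ContinuousOn (fun t : ℝ => ‖(q + t • (s - q)) - g‖) (Set.Icc 0 1) := by fun_prop
  have hiv := intermediate_value_Icc' (zero_le_one) hc
  have hm : 3 * r ∈ Set.Icc ‖(q + (1:ℝ) • (s - q)) - g‖ ‖(q + (0:ℝ) • (s - q)) - g‖ := by
    constructor
    · simp; linarith
    · simp; linarith
  obtain ⟨t, ⟨ht0, ht1⟩, ht⟩ := hiv hm
  simp only at ht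
  refine ⟨q + t • (s - q), ?_, ht.le, ?_⟩
  · rw [segment_eq_image']; exact ⟨t, ⟨ht0, ht1⟩, rfl⟩
  have hn : ‖q + t • (s - q) - q‖ = t * ‖s - q‖ := by
    rw [add_sub_cancel_left, norm_smul, Real.norm_eq_abs, abs_of_nonneg ht0]
  rw [hn]
  set v := s - q with hv
  set b := q + t • v with hb
  set N := ‖v‖ with hN
  have hN0 : 0 ≤ N := norm_nonneg _
  set I := inner ℝ (b - g) v with hI
  have e1 : ‖q - g‖ ^ 2 = 9 * r ^ 2 - 2 * t * I + t ^ 2 * N ^ 2 := by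
    have : q - g = (b - g) - t • v := by rw [hb]; abel
    rw [this, norm_sub_sq_real, ht, real_inner_smul_right, norm_smul, mul_pow, mul_pow, Real.norm_eq_abs, sq_abs]
    ring
  have e2 : ‖s - g‖ ^ 2 = 9 * r ^ 2 + 2 * (1 - t) * I + (1 - t) ^ 2 * N ^ 2 := by
    have : s - g = (b - g) + (1 - t) • v := by rw [hb, hv, sub_smul, one_smul]; abel
    rw [this, norm_add_sq_real, ht, real_inner_smul_right, norm_smul, mul_pow, mul_pow, Real.norm_eq_abs, sq_abs]
    ring
  have hs2 : ‖s - g‖ ^ 2 ≤ r ^ 2 := pow_le_pow_left₀ (norm_nonneg _) hs 2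
  have hI' : 8 / 3 * r * N ≤ - I := by
    rcases eq_or_lt_of_le ht1 with h1 | h1
    · have hr0 : r = 0 := by
        subst h1; norm_num at e2; nlinarith
      have : b - g = 0 := by rw [← norm_eq_zero, ht, hr0]; simp
      rw [hI, this, hr0]; simp
    · have hk : 0 < 1 - t := by linarith
      have : 2 * (1 - t) * (8 / 3 * r * N) ≤ 2 * (1 - t) * (- I) := by
        nlinarith [sq_nonneg ((8/3) * r - (1 - t) * N), sq_nonneg r]
      exact le_of_mul_le_mul_left this (by linarith)
  have hq2 : ‖q - g‖ ^ 2 ≤ (3 * r + e) ^ 2 := pow_le_pow_left₀ (norm_nonneg _) hq 2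
  by_contra! hlt
  have h6 : t * (8 / 3 * r * N) ≤ t * (- I) := mul_le_mul_of_nonneg_left hI' ht0
  set D := t * N
  nlinarith [mul_nonneg hr (sub_nonneg.2 hlt.le), mul_nonneg he (sub_nonneg.2 hlt.le), mul_self_nonneg e, mul_pos (sub_pos.2 hlt) (sub_pos.2 hlt)]

theorem kz_helly4 {X : Type*} [NormedAddCommGroup X] [InnerProductSpace ℝ X]
    (hdim : Module.finrank ℝ X = 2) {A B C D : Set X}
    (hA : Convex ℝ A) (hB : Convex ℝ B) (hC : Convex ℝ C) (hD : Convex ℝ D)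
    (h1 : ∃ p, p ∈ A ∧ p ∈ B ∧ p ∈ C) (h2 : ∃ p, p ∈ A ∧ p ∈ B ∧ p ∈ D)
    (h3 : ∃ p, p ∈ A ∧ p ∈ C ∧ p ∈ D) (h4 : ∃ p, p ∈ B ∧ p ∈ C ∧ p ∈ D) :
    ∃ p, p ∈ A ∧ p ∈ B ∧ p ∈ C ∧ p ∈ D := by
  have hfd : FiniteDimensional ℝ X := Module.finite_of_finrank_pos (by omega)
  have h := Convex.helly_theorem (𝕜 := ℝ) (F := ![A, B, C, D]) (s := Finset.univ)
    (by rw [hdim]; simp) (by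
      intro i _
      fin_cases i <;> simpa) (by
      intro I _ hI
      rw [hdim] at hI
      have hc : (Iᶜ).card = 1 := by rw [Finset.card_compl, hI]; simp
      obtain ⟨j, hj⟩ := Finset.card_eq_one.1 hc
      have hmem : ∀ i ∈ I, i ≠ j := by
        intro i hi e
        have : i ∈ Iᶜ := by rw [hj, e]; simp
        exact (Finset.mem_compl.1 this) hi
      obtain ⟨p1, hp1⟩ := h1
      obtain ⟨p2, hp2⟩ := h2
      obtain ⟨p3, hp3⟩ := h3
      obtain ⟨p4, hp4⟩ := h4
      fin_cases j
      · refine ⟨p4, ?_⟩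
        simp only [Set.mem_iInter]
        intro i hi
        have := hmem i hi
        fin_cases i <;> simp_all
      · refine ⟨p3, ?_⟩
        simp only [Set.mem_iInter]
        intro i hi
        have := hmem i hi
        fin_cases i <;> simp_all
      · refine ⟨p2, ?_⟩
        simp only [Set.mem_iInter]
        intro i hi
        have := hmem i hi
        fin_cases i <;> simp_all
      · refine ⟨p1, ?_⟩
        simp only [Set.mem_iInter]
        intro i hi
        have := hmem i hi
        fin_cases i <;> simp_all)
  obtain ⟨p, hp⟩ := h
  simp only [Set.mem_iInter, Finset.mem_univ, true_imp_iff] at hp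
  exact ⟨p, hp 0, hp 1, hp 2, hp 3⟩

theorem kz_helly3 {X ι : Type*} [NormedAddCommGroup X] [InnerProductSpace ℝ X]
    (hdim : Module.finrank ℝ X = 2) (K : ι → Set X)
    (hv : ∀ i, Convex ℝ (K i)) (hc : ∀ i, IsCompact (K i))
    (h : ∀ i j k, ∃ p, p ∈ K i ∧ p ∈ K j ∧ p ∈ K k) : ∃ p, ∀ i, p ∈ K i := by
  classical
  have hfd : FiniteDimensional ℝ X := Module.finite_of_finrank_pos (by omega)
  have := Convex.helly_theorem_compact' (𝕜 := ℝ) hv hc (by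
    intro I hI
    rw [hdim] at hI
    have : ∀ n, n = I.card → (⋂ i ∈ I, K i).Nonempty := by
      intro n hn
      have hn3 : n ≤ 3 := by omega
      interval_cases n
      · rw [Finset.card_eq_zero.1 hn.symm]; simp
      · obtain ⟨i, rfl⟩ := Finset.card_eq_one.1 hn.symm
        obtain ⟨p, hp, _⟩ := h i i i
        exact ⟨p, by simpa⟩
      · obtain ⟨i, j, _, rfl⟩ := Finset.card_eq_two.1 hn.symm
        obtain ⟨p, hp, hp', _⟩ := h i j j
        exact ⟨p, by simp [hp, hp']⟩
      · obtain ⟨i, j, k, _, _, _, rfl⟩ := Finset.card_eq_three.1 hn.symm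
        obtain ⟨p, hp, hp', hp''⟩ := h i j k
        exact ⟨p, by simp [hp, hp', hp'']⟩
    exact this _ rfl)
  obtain ⟨p, hp⟩ := this
  exact ⟨p, by simpa using hp⟩

theorem kz_hellyNear {X ι : Type*} [NormedAddCommGroup X] [InnerProductSpace ℝ X]
    (hdim : Module.finrank ℝ X = 2) (K : ι → Set X)
    (hv : ∀ i, Convex ℝ (K i)) (hc : ∀ i, IsCompact (K i))
    (h : ∀ i j k, ∃ p, p ∈ K i ∧ p ∈ K j ∧ p ∈ K k) (a : X) (t : ℝ) (ht : 0 ≤ t)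
    (h2 : ∀ i j, ∃ p, p ∈ K i ∧ p ∈ K j ∧ ‖a - p‖ ≤ t) :
    ∃ p, (∀ i, p ∈ K i) ∧ ‖a - p‖ ≤ t := by
  have hfd : FiniteDimensional ℝ X := Module.finite_of_finrank_pos (by omega)
  have hpr : ProperSpace X := FiniteDimensional.proper ℝ X
  have hb : ∀ p : X, p ∈ closedBall a t ↔ ‖a - p‖ ≤ t := fun p => by
    rw [mem_closedBall, dist_eq_norm, norm_sub_rev]
  obtain ⟨p, hp⟩ := kz_helly3 hdim (fun o : Option ι => o.elim (closedBall a t) K)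
    (by rintro (_ | i)
        · exact convex_closedBall _ _
        · exact hv i)
    (by rintro (_ | i)
        · exact isCompact_closedBall _ _
        · exact hc i)
    (by
      rintro (_ | i) (_ | j) (_ | k) <;> simp only [Option.elim, hb]
      · exact ⟨a, by simpa⟩
      · obtain ⟨p, h1, h2, h3⟩ := h2 k k; exact ⟨p, h3, h3, h1⟩
      · obtain ⟨p, h1, h2, h3⟩ := h2 j j; exact ⟨p, h3, h1, h3⟩
      · obtain ⟨p, h1, h2, h3⟩ := h2 j k; exact ⟨p, h3, h1, h2⟩
      · obtain ⟨p, h1, h2, h3⟩ := h2 i i; exact ⟨p, h1, h3, h3⟩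
      · obtain ⟨p, h1, h2, h3⟩ := h2 i k; exact ⟨p, h1, h3, h2⟩
      · obtain ⟨p, h1, h2, h3⟩ := h2 i j; exact ⟨p, h1, h2, h3⟩
      · exact h i j k)
  exact ⟨p, fun i => hp (some i), (hb p).1 (hp none)⟩

theorem kz_prop {X : Type*} [NormedAddCommGroup X] [InnerProductSpace ℝ X]
    (hdim : Module.finrank ℝ X = 2) {C C1 C2 : Set X}
    (hC : Convex ℝ C) (hC1 : Convex ℝ C1) (hC2 : Convex ℝ C2)
    {r eg eq : ℝ} (hr : 0 ≤ r) (heg : 0 ≤ eg) (hge : eg ≤ eq) {a p c g q1 q2 c1 c2 : X}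
    (hp1 : p ∈ C1) (hp2 : p ∈ C2) (hc : c ∈ C) (hcp : ‖c - p‖ ≤ r)
    (hg1 : g ∈ C1) (hg2 : g ∈ C2) (hga : ‖g - a‖ ≤ 3 * r + eg)
    (hq1 : q1 ∈ C) (hq1a : ‖q1 - a‖ ≤ eq) (hc1 : c1 ∈ C1) (hqc1 : ‖q1 - c1‖ ≤ r)
    (hq2 : q2 ∈ C) (hq2a : ‖q2 - a‖ ≤ eq) (hc2 : c2 ∈ C2) (hqc2 : ‖q2 - c2‖ ≤ r) :
    ∃ b ∈ C, ∃ h, h ∈ C1 ∧ h ∈ C2 ∧ ‖b - h‖ ≤ 3 * r ∧ ‖b - a‖ ≤ eq + 9 / 8 * (eg + eq) := by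
  set R := max (3 * r + eg) (r + eq) with hR
  have hR1 : 3 * r + eg ≤ R := le_max_left _ _
  have hR2 : r + eq ≤ R := le_max_right _ _
  have tri : ∀ u v w : X, ‖u - w‖ ≤ ‖u - v‖ + ‖v - w‖ := fun u v w => norm_sub_le_norm_sub_add_norm_sub u v w
  obtain ⟨g', hT, hg'1, hg'2, hg'a⟩ := kz_helly4 hdim (convex_convexHull ℝ ({p, c1, c2} : Set X)) hC1 hC2
    (convex_closedBall a R)
    ⟨p, subset_convexHull _ _ (by simp), hp1, hp2⟩
    ⟨c1, subset_convexHull _ _ (by simp), hc1, by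
      rw [mem_closedBall, dist_eq_norm]
      have := tri c1 q1 a
      rw [norm_sub_rev c1 q1] at this; linarith⟩
    ⟨c2, subset_convexHull _ _ (by simp), hc2, by
      rw [mem_closedBall, dist_eq_norm]
      have := tri c2 q2 a
      rw [norm_sub_rev c2 q2] at this; linarith⟩
    ⟨g, hg1, hg2, by rw [mem_closedBall, dist_eq_norm]; linarith⟩
  rw [mem_closedBall, dist_eq_norm] at hg'a
  have hs : ∃ s ∈ C, ‖s - g'‖ ≤ r := by
    have hsub : convexHull ℝ ({p, c1, c2} : Set X) ⊆ C + closedBall (0 : X) r := by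
      apply convexHull_min _ (hC.add (convex_closedBall _ _))
      have aux : ∀ u ∈ C, ∀ v, ‖u - v‖ ≤ r → v ∈ C + closedBall (0 : X) r := by
        intro u hu v huv
        refine Set.mem_add.2 ⟨u, hu, v - u, ?_, by abel⟩
        rw [mem_closedBall_zero_iff, norm_sub_rev]; exact huv
      rintro x (rfl | rfl | rfl)
      · exact aux c hc _ hcp
      · exact aux q1 hq1 _ hqc1
      · exact aux q2 hq2 _ hqc2
    obtain ⟨s, hs, w, hw, e⟩ := Set.mem_add.1 (hsub hT)
    refine ⟨s, hs, ?_⟩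
    rw [← e, sub_add_cancel_left, norm_neg]
    simpa using hw
  obtain ⟨s, hsC, hsg⟩ := hs
  rcases le_total (r + eq) (3 * r + eg) with hcase | hcase
  · have hRe : R = 3 * r + eg := max_eq_left hcase
    obtain ⟨b, hb, hb1, hb2⟩ := kz_move q1 s g' r (eg + eq) hr (by linarith)
      (by have := tri q1 a g'; rw [norm_sub_rev a] at this; linarith) hsg
    refine ⟨b, hC.segment_subset hq1 hsC hb, g', hg'1, hg'2, hb1, ?_⟩
    have := tri b q1 a
    linarith
  · have hRe : R = r + eq := max_eq_right hcase
    refine ⟨s, hsC, g', hg'1, hg'2, by linarith, ?_⟩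
    have := tri s g' a
    linarith

/-- Closed neighbourhood, as a Minkowski sum. -/
def kzN {X : Type*} [NormedAddCommGroup X] (S : Set X) (t : ℝ) : Set X := S + closedBall (0 : X) t

theorem kzN_mem {X : Type*} [NormedAddCommGroup X] {S : Set X} {t : ℝ} {p : X} :
    p ∈ kzN S t ↔ ∃ v ∈ S, ‖p - v‖ ≤ t := by
  unfold kzN
  rw [Set.mem_add]
  constructor
  · rintro ⟨v, hv, w, hw, rfl⟩
    exact ⟨v, hv, by simpa using hw⟩
  · rintro ⟨v, hv, h⟩
    exact ⟨v, hv, p - v, by simpa using h, by abel⟩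

theorem kzN_mono {X : Type*} [NormedAddCommGroup X] {S : Set X} {s t : ℝ} {p q : X}
    (hp : p ∈ kzN S s) (h : s + ‖p - q‖ ≤ t) : q ∈ kzN S t := by
  obtain ⟨v, hv, hpv⟩ := kzN_mem.1 hp
  refine kzN_mem.2 ⟨v, hv, ?_⟩
  have := norm_sub_le_norm_sub_add_norm_sub q p v
  rw [norm_sub_rev q p] at this
  linarith

theorem kzN_le {X : Type*} [NormedAddCommGroup X] {S : Set X} {s t : ℝ} {p : X}
    (hp : p ∈ kzN S s) (h : s ≤ t) : p ∈ kzN S t := kzN_mono hp (by simpa)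

theorem kzN_split {X : Type*} [NormedAddCommGroup X] [InnerProductSpace ℝ X] {S : Set X} {s t : ℝ}
    {p : X} (hs : 0 ≤ s) (ht : 0 ≤ t)
    (hp : p ∈ kzN S (s + t)) : ∃ q ∈ kzN S s, ‖p - q‖ ≤ t := by
  obtain ⟨v, hv, hpv⟩ := kzN_mem.1 hp
  obtain ⟨y, h1, h2⟩ := exists_dist_le_le (x := p) (z := v) ht hs (by rw [dist_eq_norm]; linarith)
  rw [dist_eq_norm] at h1 h2
  exact ⟨y, kzN_mem.2 ⟨v, hv, h2⟩, h1⟩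

theorem kzN_convex {X : Type*} [NormedAddCommGroup X] [InnerProductSpace ℝ X] {S : Set X}
    (hS : Convex ℝ S) (t : ℝ) : Convex ℝ (kzN S t) := hS.add (convex_closedBall _ _)

theorem kzN_compact {X : Type*} [NormedAddCommGroup X] [InnerProductSpace ℝ X]
    (hdim : Module.finrank ℝ X = 2) {S : Set X}
    (hS : IsCompact S) (t : ℝ) : IsCompact (kzN S t) := by
  have hfd : FiniteDimensional ℝ X := Module.finite_of_finrank_pos (by omega)
  have hpr : ProperSpace X := FiniteDimensional.proper ℝ X
  exact hS.add (isCompact_closedBall _ _)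

/-- The pair sets. -/
def kzH {E X : Type*} [NormedAddCommGroup E] [NormedAddCommGroup X] (F : E → Set X) (z u v : E) :
    Set X := kzN (F u) ‖z - u‖ ∩ kzN (F v) ‖z - v‖

/-- Two-point consequence of the finiteness hypothesis and of the extension theorem. -/
def kzSel {E X : Type*} [NormedAddCommGroup E] [NormedAddCommGroup X] (M : Set E) (F : E → Set X) :
    Prop :=
  ∀ u1 ∈ M, ∀ u2 ∈ M, ∀ u3 ∈ M, ∀ u4 ∈ M, ∀ z w : E, ∃ p q : X, ‖p - q‖ ≤ ‖z - w‖ ∧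
    (p ∈ kzN (F u1) ‖z - u1‖ ∧ p ∈ kzN (F u2) ‖z - u2‖ ∧ p ∈ kzN (F u3) ‖z - u3‖ ∧
      p ∈ kzN (F u4) ‖z - u4‖) ∧
    (q ∈ kzN (F u1) ‖w - u1‖ ∧ q ∈ kzN (F u2) ‖w - u2‖ ∧ q ∈ kzN (F u3) ‖w - u3‖ ∧
      q ∈ kzN (F u4) ‖w - u4‖)

theorem kz_sel {E X : Type*} [NormedAddCommGroup E] [InnerProductSpace ℝ E]
    [NormedAddCommGroup X] [InnerProductSpace ℝ X] (M : Set E) (F : E → Set X)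
    (hfin : ∀ M' : Finset E, ↑M' ⊆ M → M'.card ≤ 4 →
      ∃ f : E → X, (∀ x ∈ M', f x ∈ F x) ∧
        ∀ x ∈ M', ∀ y ∈ M', ‖f x - f y‖ ≤ ‖x - y‖) : kzSel M F := by
  classical
  intro u1 h1 u2 h2 u3 h3 u4 h4 z w
  obtain ⟨f, hf, hl⟩ := hfin {u1, u2, u3, u4} (by
    intro x hx
    simp at hx
    rcases hx with rfl | rfl | rfl | rfl <;> assumption) Finset.card_le_four
  obtain ⟨g, hg, hgl⟩ := kz_ext _ f hl z
  obtain ⟨k, hk, hkl⟩ := kz_ext (insert z {u1, u2, u3, u4}) g (by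
    intro x hx y hy
    exact hgl x (by simpa using hx) y (by simpa using hy)) w
  have hF : ∀ u ∈ ({u1, u2, u3, u4} : Finset E), k u ∈ F u := by
    intro u hu
    rw [hk u (Finset.mem_insert_of_mem hu), hg u hu]
    exact hf u hu
  have hd : ∀ y, y = z ∨ y = w → ∀ u ∈ ({u1, u2, u3, u4} : Finset E), k y ∈ kzN (F u) ‖y - u‖ := by
    intro y hy u hu
    refine kzN_mem.2 ⟨k u, hF u hu, hkl _ ?_ _ ?_⟩
    · rcases hy with rfl | rfl <;> simp
    · simp at hu; simp [hu]
  refine ⟨k z, k w, hkl _ (by simp) _ (by simp), ?_, ?_⟩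
  · exact ⟨hd z (by simp) _ (by simp), hd z (by simp) _ (by simp), hd z (by simp) _ (by simp), hd z (by simp) _ (by simp)⟩
  · exact ⟨hd w (by simp) _ (by simp), hd w (by simp) _ (by simp), hd w (by simp) _ (by simp), hd w (by simp) _ (by simp)⟩

theorem kz_sorted {E X : Type*} [NormedAddCommGroup E] [InnerProductSpace ℝ E]
    [NormedAddCommGroup X] [InnerProductSpace ℝ X] (hdim : Module.finrank ℝ X = 2)
    {M : Set E} {F : E → Set X} (hFcv : ∀ x ∈ M, Convex ℝ (F x)) (hsel : kzSel M F)
    (x : E) {z1 z2 z3 u1 u2 u3 v1 v2 v3 : E} (hu1 : u1 ∈ M) (hu2 : u2 ∈ M) (hu3 : u3 ∈ M)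
    (hv1 : v1 ∈ M) (hv2 : v2 ∈ M) (hv3 : v3 ∈ M) (h12 : ‖x - z1‖ ≤ ‖x - z2‖)
    (h23 : ‖x - z2‖ ≤ ‖x - z3‖) :
    ∃ p, p ∈ kzN (kzH F z1 u1 v1) (3 * ‖x - z1‖) ∧ p ∈ kzN (kzH F z2 u2 v2) (3 * ‖x - z2‖) ∧
      p ∈ kzN (kzH F z3 u3 v3) (3 * ‖x - z3‖) := by
  have cA : ∀ u ∈ M, ∀ t, Convex ℝ (kzN (F u) t) := fun u hu t => kzN_convex (hFcv u hu) t
  have cH : ∀ z, ∀ u ∈ M, ∀ v ∈ M, Convex ℝ (kzH F z u v) := fun z u hu v hv =>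
    (cA u hu _).inter (cA v hv _)
  have dz : ∀ z w : E, ‖z - w‖ ≤ ‖x - z‖ + ‖x - w‖ := fun z w => by
    have := norm_sub_le_norm_sub_add_norm_sub z x w
    rwa [norm_sub_rev z x] at this
  set r1 := ‖x - z1‖
  set r2 := ‖x - z2‖
  set r3 := ‖x - z3‖
  have hr1 : 0 ≤ r1 := norm_nonneg _
  have claim : ∀ u ∈ M, ∃ q, q ∈ kzN (F u) ‖z1 - u‖ ∧ q ∈ kzN (kzH F z2 u2 v2) (r1 + r2) ∧
      q ∈ kzN (kzH F z3 u3 v3) (r1 + 2 * r2 + r3) := by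
    intro u hu
    have tu : ‖z2 - u‖ ≤ ‖z1 - u‖ + (r1 + r2) := by
      have := norm_sub_le_norm_sub_add_norm_sub z2 z1 u
      have := dz z2 z1
      linarith
    obtain ⟨p, hp1, hp2, hp3, hp4⟩ := kz_helly4 hdim (cA u2 hu2 ‖z2 - u2‖) (cA v2 hv2 ‖z2 - v2‖)
      (cA u hu (‖z1 - u‖ + (r1 + r2))) (kzN_convex (cH z3 u3 hu3 v3 hv3) (r2 + r3))
      (by
        obtain ⟨p, q, h, ⟨a1, a2, a3, a4⟩, -⟩ := hsel u2 hu2 v2 hv2 u hu u hu z2 z2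
        exact ⟨p, a1, a2, kzN_le a3 tu⟩)
      (by
        obtain ⟨p, q, h, ⟨a1, a2, a3, a4⟩, b1, b2, b3, b4⟩ := hsel u2 hu2 v2 hv2 u3 hu3 v3 hv3 z2 z3
        exact ⟨p, a1, a2, kzN_mem.2 ⟨q, ⟨b3, b4⟩, h.trans (dz _ _)⟩⟩)
      (by
        obtain ⟨p, q, h, ⟨a1, a2, a3, a4⟩, b1, b2, b3, b4⟩ := hsel u2 hu2 u hu u3 hu3 v3 hv3 z2 z3
        exact ⟨p, a1, kzN_le a2 tu, kzN_mem.2 ⟨q, ⟨b3, b4⟩, h.trans (dz _ _)⟩⟩)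
      (by
        obtain ⟨p, q, h, ⟨a1, a2, a3, a4⟩, b1, b2, b3, b4⟩ := hsel v2 hv2 u hu u3 hu3 v3 hv3 z2 z3
        exact ⟨p, a1, kzN_le a2 tu, kzN_mem.2 ⟨q, ⟨b3, b4⟩, h.trans (dz _ _)⟩⟩)
    obtain ⟨q, hq, hpq⟩ := kzN_split (norm_nonneg _) (by linarith) hp3
    refine ⟨q, hq, kzN_mem.2 ⟨p, ⟨hp1, hp2⟩, by rwa [norm_sub_rev]⟩, kzN_mono hp4 (by linarith)⟩
  obtain ⟨p, hp1, hp2, hp3, hp4⟩ := kz_helly4 hdim (cA u1 hu1 ‖z1 - u1‖) (cA v1 hv1 ‖z1 - v1‖)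
      (kzN_convex (cH z2 u2 hu2 v2 hv2) (r1 + r2)) (kzN_convex (cH z3 u3 hu3 v3 hv3) (r1 + 2 * r2 + r3))
      (by
        obtain ⟨p, q, h, ⟨a1, a2, a3, a4⟩, b1, b2, b3, b4⟩ := hsel u1 hu1 v1 hv1 u2 hu2 v2 hv2 z1 z2
        exact ⟨p, a1, a2, kzN_mem.2 ⟨q, ⟨b3, b4⟩, h.trans (dz _ _)⟩⟩)
      (by
        obtain ⟨p, q, h, ⟨a1, a2, a3, a4⟩, b1, b2, b3, b4⟩ := hsel u1 hu1 v1 hv1 u3 hu3 v3 hv3 z1 z3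
        exact ⟨p, a1, a2, kzN_mem.2 ⟨q, ⟨b3, b4⟩, h.trans ((dz _ _).trans (by linarith))⟩⟩)
      (claim u1 hu1) (claim v1 hv1)
  obtain ⟨q, hq, hpq⟩ := kzN_split (s := 2 * r2 + r3) (t := r1) (by linarith) hr1
    (kzN_le hp4 (by linarith))
  refine ⟨q, kzN_mem.2 ⟨p, ⟨hp1, hp2⟩, ?_⟩, kzN_mono hp3 (by linarith), kzN_le hq (by linarith)⟩
  rw [norm_sub_rev]; linarith

theorem kz_triple {E X : Type*} [NormedAddCommGroup E] [InnerProductSpace ℝ E]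
    [NormedAddCommGroup X] [InnerProductSpace ℝ X] (hdim : Module.finrank ℝ X = 2)
    {M : Set E} {F : E → Set X} (hFcv : ∀ x ∈ M, Convex ℝ (F x)) (hsel : kzSel M F)
    (x : E) {z1 z2 z3 u1 u2 u3 v1 v2 v3 : E} (hu1 : u1 ∈ M) (hu2 : u2 ∈ M) (hu3 : u3 ∈ M)
    (hv1 : v1 ∈ M) (hv2 : v2 ∈ M) (hv3 : v3 ∈ M) :
    ∃ p, p ∈ kzN (kzH F z1 u1 v1) (3 * ‖x - z1‖) ∧ p ∈ kzN (kzH F z2 u2 v2) (3 * ‖x - z2‖) ∧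
      p ∈ kzN (kzH F z3 u3 v3) (3 * ‖x - z3‖) := by
  rcases le_total ‖x - z1‖ ‖x - z2‖ with a | a <;> rcases le_total ‖x - z2‖ ‖x - z3‖ with b | b <;>
    rcases le_total ‖x - z1‖ ‖x - z3‖ with c | c
  · exact kz_sorted hdim hFcv hsel x hu1 hu2 hu3 hv1 hv2 hv3 a b
  · exact kz_sorted hdim hFcv hsel x hu1 hu2 hu3 hv1 hv2 hv3 a b
  · obtain ⟨p, h1, h2, h3⟩ := kz_sorted hdim hFcv hsel x hu1 hu3 hu2 hv1 hv3 hv2 c b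
    exact ⟨p, h1, h3, h2⟩
  · obtain ⟨p, h1, h2, h3⟩ := kz_sorted hdim hFcv hsel x hu3 hu1 hu2 hv3 hv1 hv2 c a
    exact ⟨p, h2, h3, h1⟩
  · obtain ⟨p, h1, h2, h3⟩ := kz_sorted hdim hFcv hsel x hu2 hu1 hu3 hv2 hv1 hv3 a c
    exact ⟨p, h2, h1, h3⟩
  · obtain ⟨p, h1, h2, h3⟩ := kz_sorted hdim hFcv hsel x hu2 hu3 hu1 hv2 hv3 hv1 b c
    exact ⟨p, h3, h1, h2⟩
  · obtain ⟨p, h1, h2, h3⟩ := kz_sorted hdim hFcv hsel x hu3 hu2 hu1 hv3 hv2 hv1 b a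
    exact ⟨p, h3, h2, h1⟩
  · obtain ⟨p, h1, h2, h3⟩ := kz_sorted hdim hFcv hsel x hu3 hu2 hu1 hv3 hv2 hv1 b a
    exact ⟨p, h3, h2, h1⟩

/-- The pair estimate for the Hausdorff distance. -/
theorem kz_pair {E X : Type*} [NormedAddCommGroup E] [InnerProductSpace ℝ E]
    [NormedAddCommGroup X] [InnerProductSpace ℝ X] (hdim : Module.finrank ℝ X = 2)
    {M : Set E} {F : E → Set X} (hFcv : ∀ x ∈ M, Convex ℝ (F x)) (hsel : kzSel M F)
    (x y : E) {z1 z2 u1 u2 v1 v2 : E} (hu1 : u1 ∈ M) (hu2 : u2 ∈ M)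
    (hv1 : v1 ∈ M) (hv2 : v2 ∈ M) (a e : X)
    (ha1 : a ∈ kzN (kzH F z1 u1 v1) (3 * ‖x - z1‖)) (ha2 : a ∈ kzN (kzH F z2 u2 v2) (3 * ‖x - z2‖))
    (he : ∀ u ∈ M, e ∈ kzN (F u) ‖y - u‖) (hea : ‖e - a‖ ≤ 3 * ‖x - y‖) :
    ∃ b, b ∈ kzN (kzH F z1 u1 v1) (3 * ‖y - z1‖) ∧ b ∈ kzN (kzH F z2 u2 v2) (3 * ‖y - z2‖) ∧
      ‖a - b‖ ≤ 25 * ‖x - y‖ := by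
  have cA : ∀ u ∈ M, ∀ t, Convex ℝ (kzN (F u) t) := fun u hu t => kzN_convex (hFcv u hu) t
  have cH : ∀ z, ∀ u ∈ M, ∀ v ∈ M, Convex ℝ (kzH F z u v) := fun z u hu v hv =>
    (cA u hu _).inter (cA v hv _)
  have tx : ∀ z, ‖x - z‖ ≤ ‖x - y‖ + ‖y - z‖ := fun z => norm_sub_le_norm_sub_add_norm_sub x y z
  have ty : ∀ z u, ‖y - u‖ ≤ ‖z - u‖ + ‖y - z‖ := fun z u => by
    have := norm_sub_le_norm_sub_add_norm_sub y z u
    linarith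
  set d := ‖x - y‖
  have hd : 0 ≤ d := norm_nonneg _
  obtain ⟨g1, ⟨hg1, hg1'⟩, hga1⟩ := kzN_mem.1 ha1
  obtain ⟨g2, ⟨hg2, hg2'⟩, hga2⟩ := kzN_mem.1 ha2
  have enear : ∀ z, ∀ u ∈ M, ∃ c ∈ kzN (F u) ‖z - u‖, ‖e - c‖ ≤ ‖y - z‖ := fun z u hu =>
    kzN_split (norm_nonneg _) (norm_nonneg _) (kzN_le (he u hu) (ty z u))
  have stage1 : ∀ u ∈ M, ∃ b, b ∈ kzN (F u) (‖z1 - u‖ + ‖y - z1‖) ∧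
      b ∈ kzN (kzH F z2 u2 v2) (3 * ‖y - z2‖) ∧ ‖b - a‖ ≤ 39 / 4 * d := by
    intro u hu
    obtain ⟨c1, hc1, hec1⟩ := enear z2 u2 hu2
    obtain ⟨c2, hc2, hec2⟩ := enear z2 v2 hv2
    obtain ⟨c, p, hcp, ⟨-, -, hc, -⟩, hp1, hp2, -⟩ := hsel u2 hu2 v2 hv2 u hu u hu y z2
    have heC : e ∈ kzN (F u) (‖z1 - u‖ + ‖y - z1‖) := kzN_le (he u hu) (ty _ _)
    obtain ⟨b, hb, h, hh1, hh2, hbh, hba⟩ := kz_prop hdim (cA u hu (‖z1 - u‖ + ‖y - z1‖))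
      (cA u2 hu2 ‖z2 - u2‖) (cA v2 hv2 ‖z2 - v2‖) (r := ‖y - z2‖) (eg := 3 * d) (eq := 3 * d)
      (a := a) (norm_nonneg _) (by positivity) le_rfl hp1 hp2 (kzN_le hc (ty _ _)) hcp hg2 hg2'
      (by rw [norm_sub_rev]; linarith [tx z2]) heC hea hc1 hec1 heC hea hc2 hec2
    exact ⟨b, hb, kzN_mem.2 ⟨h, ⟨hh1, hh2⟩, hbh⟩, by linarith⟩
  obtain ⟨q1, hq1, hq1C, hq1a⟩ := stage1 u1 hu1
  obtain ⟨q2, hq2, hq2C, hq2a⟩ := stage1 v1 hv1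
  obtain ⟨c1, hc1, hqc1⟩ := kzN_split (norm_nonneg _) (norm_nonneg _) hq1
  obtain ⟨c2, hc2, hqc2⟩ := kzN_split (norm_nonneg _) (norm_nonneg _) hq2
  obtain ⟨p, w, hpw, ⟨hp1, hp2, -, -⟩, -, -, hw1, hw2⟩ := hsel u1 hu1 v1 hv1 u2 hu2 v2 hv2 z1 z2
  have hyz : ‖z1 - z2‖ ≤ ‖y - z1‖ + ‖y - z2‖ := by
    have := norm_sub_le_norm_sub_add_norm_sub z1 y z2
    rwa [norm_sub_rev z1 y] at this
  have hpN : p ∈ kzN (kzH F z2 u2 v2) (‖y - z2‖ + ‖y - z1‖) :=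
    kzN_mem.2 ⟨w, ⟨hw1, hw2⟩, by linarith⟩
  obtain ⟨c, hc, hpc⟩ := kzN_split (norm_nonneg _) (norm_nonneg _) hpN
  obtain ⟨b, hb, h, hh1, hh2, hbh, hba⟩ := kz_prop hdim
      (kzN_convex (cH z2 u2 hu2 v2 hv2) (3 * ‖y - z2‖))
      (cA u1 hu1 ‖z1 - u1‖) (cA v1 hv1 ‖z1 - v1‖) (r := ‖y - z1‖) (eg := 3 * d) (eq := 39 / 4 * d)
      (a := a) (norm_nonneg _) (by positivity) (by linarith) hp1 hp2
      (kzN_le hc (by linarith [norm_nonneg (y - z2)])) (by rwa [norm_sub_rev]) hg1 hg1'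
      (by rw [norm_sub_rev]; linarith [tx z1]) hq1C hq1a hc1 hqc1 hq2C hq2a hc2 hqc2
  exact ⟨b, kzN_mem.2 ⟨h, ⟨hh1, hh2⟩, hbh⟩, hb, by rw [norm_sub_rev]; linarith⟩

theorem core_euclidean_domain_euclidean_target
    {E : Type*} [NormedAddCommGroup E] [InnerProductSpace ℝ E]
    (M : Set E)
    {X : Type*} [NormedAddCommGroup X] [InnerProductSpace ℝ X]
    (hdim : Module.finrank ℝ X = 2)
    (F : E → Set X)
    (hFne : ∀ x ∈ M, (F x).Nonempty)
    (hFcp : ∀ x ∈ M, IsCompact (F x))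
    (hFcv : ∀ x ∈ M, Convex ℝ (F x))
    -- finiteness hypothesis: selections on subsets of `M` of at most 4 points
    (hfin : ∀ M' : Finset E, ↑M' ⊆ M → M'.card ≤ 4 →
      ∃ f : E → X, (∀ x ∈ M', f x ∈ F x) ∧
        ∀ x ∈ M', ∀ y ∈ M', ‖f x - f y‖ ≤ ‖x - y‖)
    -- the first and second balanced refinements of `F`, with `λ₁ = 1`, `λ₂ = 3`
    (F1 F2 : E → Set X)
    (hF1 : ∀ x, F1 x = ⋂ z ∈ M, F z + closedBall (0 : X) (1 * ‖x - z‖))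
    (hF2 : ∀ x, F2 x = ⋂ z ∈ M, F1 z + closedBall (0 : X) (3 * ‖x - z‖)) :
    (∀ x ∈ M, (F2 x).Nonempty) ∧
      ∀ x ∈ M, ∀ y ∈ M, hausDistB (F2 x) (F2 y) ≤ 25 * ‖x - y‖ := by
  have hsel := kz_sel M F hfin
  have m1 : ∀ {z p}, p ∈ F1 z ↔ ∀ u ∈ M, p ∈ kzN (F u) ‖z - u‖ := by
    intro z p
    rw [hF1]; simp only [Set.mem_iInter, one_mul]; rfl
  have m2 : ∀ {x p}, p ∈ F2 x ↔ ∀ z ∈ M, p ∈ kzN (F1 z) (3 * ‖x - z‖) := by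
    intro z p
    rw [hF2]; simp only [Set.mem_iInter]; rfl
  have cA : ∀ u ∈ M, ∀ t, Convex ℝ (kzN (F u) t) := fun u hu t => kzN_convex (hFcv u hu) t
  have kA : ∀ u ∈ M, ∀ t, IsCompact (kzN (F u) t) := fun u hu t => kzN_compact hdim (hFcp u hu) t
  have L1 : ∀ z a t, 0 ≤ t → (∀ u ∈ M, ∀ v ∈ M, a ∈ kzN (kzH F z u v) t) → a ∈ kzN (F1 z) t := by
    intro z a t ht h
    obtain ⟨p, hp, hap⟩ := kz_hellyNear hdim (fun u : M => kzN (F u) ‖z - u‖)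
      (fun u => cA u u.2 _) (fun u => kA u u.2 _)
      (by
        intro i j k
        obtain ⟨p, q, -, ⟨h1, h2, h3, -⟩, -⟩ := hsel i i.2 j j.2 k k.2 k k.2 z z
        exact ⟨p, h1, h2, h3⟩) a t ht
      (by
        intro i j
        obtain ⟨p, ⟨h1, h2⟩, h3⟩ := kzN_mem.1 (h i i.2 j j.2)
        exact ⟨p, h1, h2, h3⟩)
    exact kzN_mem.2 ⟨p, m1.2 fun u hu => hp ⟨u, hu⟩, hap⟩
  have m2' : ∀ {x p}, p ∈ F2 x ↔
      ∀ T : M × M × M, p ∈ kzN (kzH F T.1 T.2.1 T.2.2) (3 * ‖x - T.1‖) := by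
    intro x p
    rw [m2]
    constructor
    · rintro h ⟨z, u, v⟩
      obtain ⟨w, hw, hpw⟩ := kzN_mem.1 (h z z.2)
      exact kzN_mem.2 ⟨w, ⟨m1.1 hw u u.2, m1.1 hw v v.2⟩, hpw⟩
    · intro h z hz
      exact L1 z p _ (by positivity) fun u hu v hv => h (⟨z, hz⟩, ⟨u, hu⟩, ⟨v, hv⟩)
  have cK : ∀ x : E, ∀ T : M × M × M, Convex ℝ (kzN (kzH F (T.1 : E) T.2.1 T.2.2) (3 * ‖x - T.1‖)) :=
    fun x T => kzN_convex ((cA _ T.2.1.2 _).inter (cA _ T.2.2.2 _)) _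
  have kK : ∀ x : E, ∀ T : M × M × M, IsCompact (kzN (kzH F (T.1 : E) T.2.1 T.2.2) (3 * ‖x - T.1‖)) :=
    fun x T => kzN_compact hdim ((kA _ T.2.1.2 _).inter (kA _ T.2.2.2 _)) _
  have t3 : ∀ x : E, ∀ T1 T2 T3 : M × M × M, ∃ p,
      p ∈ kzN (kzH F (T1.1 : E) T1.2.1 T1.2.2) (3 * ‖x - T1.1‖) ∧
      p ∈ kzN (kzH F (T2.1 : E) T2.2.1 T2.2.2) (3 * ‖x - T2.1‖) ∧
      p ∈ kzN (kzH F (T3.1 : E) T3.2.1 T3.2.2) (3 * ‖x - T3.1‖) := fun x T1 T2 T3 =>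
    kz_triple hdim hFcv hsel x T1.2.1.2 T2.2.1.2 T3.2.1.2 T1.2.2.2 T2.2.2.2 T3.2.2.2
  have half : ∀ x ∈ M, ∀ y ∈ M, ∀ a ∈ F2 x, ∃ b ∈ F2 y, ‖a - b‖ ≤ 25 * ‖x - y‖ := by
    intro x hx y hy a ha
    obtain ⟨e, he, hae⟩ := kzN_mem.1 (m2.1 ha y hy)
    rw [m2'] at ha
    obtain ⟨b, hb, hab⟩ := kz_hellyNear hdim _ (cK y) (kK y) (t3 y) a (25 * ‖x - y‖) (by positivity)
      (fun T1 T2 => kz_pair hdim hFcv hsel x y T1.2.1.2 T2.2.1.2 T1.2.2.2 T2.2.2.2 a e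
        (ha T1) (ha T2) (m1.1 he) (by rwa [norm_sub_rev]))
    exact ⟨b, m2'.2 hb, hab⟩
  refine ⟨fun x _ => ?_, fun x hx y hy => ?_⟩
  · obtain ⟨p, hp⟩ := kz_helly3 hdim _ (cK x) (kK x) (t3 x)
    exact ⟨p, m2'.2 hp⟩
  · refine le_of_forall_pos_le_add fun ε hε => ?_
    have hn : 0 ≤ 25 * ‖x - y‖ := by positivity
    refine csInf_le ⟨0, fun r hr => hr.1.le⟩ ⟨by linarith, fun a ha => ?_, fun a ha => ?_⟩
    · obtain ⟨b, hb, hab⟩ := half x hx y hy a ha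
      exact kzN_mem.2 ⟨b, hb, by linarith⟩
    · obtain ⟨b, hb, hab⟩ := half y hy x hx a ha
      rw [norm_sub_rev y x] at hab
      exact kzN_mem.2 ⟨b, hb, by linarith⟩
end

section
/- Let (M,ρ) be a pseudometric space and X a real inner product (Euclidean) space with dim X > 1. Let F assign to each x ∈ M a nonempty compact convex subset F(x) ⊆ X of dimension at most 1 (a point or a closed bounded line segment). Assume that for every subset M' ⊆ M with at most 4 points there is a selection f : M' → X with ‖f(x) − f(y)‖ ≤ ρ(x,y) for all x,y ∈ M'. Let λ1 ≥ 1, λ2 ≥ 3λ1, and γ ≥ λ2 + 2λ2²/√(λ2²−λ1²). Then for every x ∈ M the second balanced refinement F²(x) is nonempty, and d_H(F²(x), F²(y)) ≤ γ·ρ(x,y) for all x,y ∈ M. In particular, one can take λ1 = 1, λ2 = 3, γ = 10. -/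
open Pointwise Metric

lemma mem_add_cb {X : Type*} [NormedAddCommGroup X] (A : Set X) (r : ℝ) (p : X) :
    p ∈ A + closedBall (0 : X) r ↔ ∃ a ∈ A, ‖p - a‖ ≤ r := by
  rw [Set.mem_add]
  constructor
  · rintro ⟨a, ha, b, hb, rfl⟩
    exact ⟨a, ha, by simpa using hb⟩
  · rintro ⟨a, ha, h⟩
    exact ⟨a, ha, p - a, by simpa using h, by abel⟩

lemma real_ineq (L c s T T' b : ℝ) (hc : 0 ≤ c) (hcL : c < L) (hs : 0 ≤ s) (hT : 0 ≤ T)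
    (hT' : 0 ≤ T') (hb : b ≤ L) (h1 : L ^ 2 + 2 * T * b + T ^ 2 ≤ (L + s) ^ 2)
    (h2 : L ^ 2 - 2 * T' * b + T' ^ 2 ≤ c ^ 2) : T * Real.sqrt (L ^ 2 - c ^ 2) ≤ s * L := by
  have hb0 : 0 < b := by
    by_contra h
    push Not at h
    nlinarith [mul_nonneg hT' (neg_nonneg.2 h), sq_nonneg T']
  have hsq : Real.sqrt (L ^ 2 - c ^ 2) ≤ b := by
    apply Real.sqrt_le_iff.2 ⟨hb0.le, ?_⟩
    nlinarith [sq_nonneg (T' - b)]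
  have hTb : T * b ≤ s * L := by
    by_contra h
    push Not at h
    have hTs : s < T := by
      by_contra h'
      push Not at h'
      have := mul_le_mul h' hb hb0.le hs
      linarith
    nlinarith
  exact (mul_le_mul_of_nonneg_left hsq hT).trans hTb

lemma geo {X : Type*} [NormedAddCommGroup X] [InnerProductSpace ℝ X]
    (e a' q1 : X) (L c s : ℝ) (hcL : c < L) (hs : 0 ≤ s)
    (ha : ‖a' - e‖ ≤ c) (hq : ‖q1 - e‖ ≤ L + s) (hq' : L < ‖q1 - e‖) :
    ∃ q ∈ segment ℝ a' q1, ‖q - e‖ ≤ L ∧ ‖q1 - q‖ * Real.sqrt (L ^ 2 - c ^ 2) ≤ s * L := by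
  have hc : 0 ≤ c := (norm_nonneg _).trans ha
  have hcont : ContinuousOn (fun t : ℝ => ‖a' + t • (q1 - a') - e‖) (Set.Icc 0 1) := by fun_prop
  obtain ⟨θ, ⟨hθ0, hθ1⟩, hθ⟩ := intermediate_value_Icc (zero_le_one) hcont
    (show L ∈ _ from ⟨by simpa using ha.trans hcL.le, by simpa using hq'.le⟩)
  simp only at hθ
  set q := a' + θ • (q1 - a') with hqdef
  refine ⟨q, ?_, hθ.le, ?_⟩
  · rw [segment_eq_image']; exact ⟨θ, ⟨hθ0, hθ1⟩, rfl⟩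
  have hD : q1 - a' ≠ 0 := by
    intro h
    have : q1 = a' := sub_eq_zero.1 h
    subst this
    linarith
  have hm : 0 < ‖q1 - a'‖ := norm_pos_iff.2 hD
  set m := ‖q1 - a'‖ with hmdef
  have e1 : q1 - e = (q - e) + (1 - θ) • (q1 - a') := by rw [hqdef]; module
  have e2 : a' - e = (q - e) - θ • (q1 - a') := by rw [hqdef]; module
  have e3 : q1 - q = (1 - θ) • (q1 - a') := by rw [hqdef]; module
  have hT : ‖q1 - q‖ = (1 - θ) * m := by
    rw [e3, norm_smul, Real.norm_of_nonneg (by linarith)]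
  rw [hT]
  have n1 : ‖q1 - e‖ ^ 2 = L ^ 2 + 2 * ((1 - θ) * inner ℝ (q - e) (q1 - a')) + ((1 - θ) * m) ^ 2 := by
    rw [e1, norm_add_sq_real, hθ, inner_smul_right, norm_smul, Real.norm_of_nonneg (by linarith)]
  have n2 : ‖a' - e‖ ^ 2 = L ^ 2 - 2 * (θ * inner ℝ (q - e) (q1 - a')) + (θ * m) ^ 2 := by
    rw [e2, norm_sub_sq_real, hθ, inner_smul_right, norm_smul, Real.norm_of_nonneg hθ0]
  have hcs : inner ℝ (q - e) (q1 - a') ≤ L * m := by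
    have := real_inner_le_norm (q - e) (q1 - a')
    rwa [hθ] at this
  refine real_ineq L c s _ (θ * m) (inner ℝ (q - e) (q1 - a') / m) hc hcL hs
    (mul_nonneg (by linarith) hm.le) (mul_nonneg hθ0 hm.le) ?_ ?_ ?_
  · rw [div_le_iff₀ hm]; exact hcs
  · have : L ^ 2 + 2 * ((1 - θ) * m) * (inner ℝ (q - e) (q1 - a') / m) + ((1 - θ) * m) ^ 2
      = ‖q1 - e‖ ^ 2 := by rw [n1]; field_simp
    rw [this]
    exact pow_le_pow_left₀ (norm_nonneg _) hq 2
  · have : L ^ 2 - 2 * (θ * m) * (inner ℝ (q - e) (q1 - a') / m) + (θ * m) ^ 2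
      = ‖a' - e‖ ^ 2 := by rw [n2]; field_simp
    rw [this]
    exact pow_le_pow_left₀ (norm_nonneg _) ha 2

/-- the point of the segment which is close to the end-point `e`. -/
lemma geo2 {X : Type*} [NormedAddCommGroup X] [InnerProductSpace ℝ X]
    (S : Set X) (hSc : IsCompact S) (hSv : Convex ℝ S)
    (o d : X) (hd : ‖d‖ = 1) (hSl : ∀ y ∈ S, ∃ t : ℝ, y = o + t • d)
    (a q1 : X) (L c s : ℝ) (hcL : c < L) (hs : 0 ≤ s)
    (haS : ∃ w ∈ S, ‖a - w‖ ≤ c)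
    (hseg : ∀ p ∈ segment ℝ a q1, ∃ t : ℝ, ‖p - (o + t • d)‖ ≤ c)
    (hq : ∃ w ∈ S, ‖q1 - w‖ ≤ L + s) (hq' : ∀ w ∈ S, L < ‖q1 - w‖) :
    ∃ q ∈ segment ℝ a q1, (∃ w ∈ S, ‖q - w‖ ≤ L) ∧
      ‖q1 - q‖ * Real.sqrt (L ^ 2 - c ^ 2) ≤ s * L := by
  obtain ⟨w, hw, haw⟩ := haS
  obtain ⟨w', hw', hqw'⟩ := hq
  have hc : 0 ≤ c := (norm_nonneg _).trans haw
  obtain ⟨e, heS, hemin⟩ := hSc.exists_isMinOn ⟨w, hw⟩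
    (f := fun y => ‖q1 - y‖) (by fun_prop)
  have hemin' : ∀ y ∈ S, ‖q1 - e‖ ≤ ‖q1 - y‖ := fun y hy => hemin hy
  -- variational inequality
  have hvar : ∀ y ∈ S, inner ℝ (q1 - e) (y - e) ≤ 0 := by
    refine (norm_eq_iInf_iff_real_inner_le_zero hSv heS).1 ?_
    have : Nonempty S := ⟨⟨w, hw⟩⟩
    apply le_antisymm
    · exact le_ciInf fun y => hemin' y y.2
    · exact ciInf_le (f := fun y : S => ‖q1 - y‖)
        ⟨0, by rintro _ ⟨y, rfl⟩; exact norm_nonneg _⟩ ⟨e, heS⟩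
  obtain ⟨te, hte⟩ := hSl e heS
  obtain ⟨tw, htw⟩ := hSl w hw
  have hdd : inner ℝ d d = (1 : ℝ) := by rw [real_inner_self_eq_norm_sq, hd]; norm_num
  have hpyth : ∀ (p : X) (τ : ℝ), ‖p - (e + τ • d)‖ ^ 2
      = ‖p - e‖ ^ 2 - 2 * τ * inner ℝ (p - e) d + τ ^ 2 := by
    intro p τ
    have : p - (e + τ • d) = (p - e) - τ • d := by abel
    rw [this, norm_sub_sq_real, inner_smul_right, norm_smul, hd, mul_one, Real.norm_eq_abs, sq_abs]
    ring
  have hstrip : ∀ p ∈ segment ℝ a q1, ‖p - e‖ ^ 2 - (inner ℝ (p - e) d) ^ 2 ≤ c ^ 2 := by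
    intro p hp
    obtain ⟨t, ht⟩ := hseg p hp
    have h1 : o + t • d = e + (t - te) • d := by rw [hte]; module
    rw [h1] at ht
    have h2 := pow_le_pow_left₀ (norm_nonneg _) ht 2
    rw [hpyth] at h2
    nlinarith [sq_nonneg (t - te - inner ℝ (p - e) d)]
  have hqe : L < ‖q1 - e‖ := hq' e heS
  have hqe2 : ‖q1 - e‖ ≤ L + s := (hemin' w' hw').trans hqw'
  have htq : inner ℝ (q1 - e) d ≠ (0 : ℝ) := by
    intro h0
    have := hstrip q1 (right_mem_segment ℝ a q1)
    rw [h0] at this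
    nlinarith
  have key : ∃ a' ∈ segment ℝ a q1, ‖a' - e‖ ≤ c := by
    by_cases hneg : inner ℝ (q1 - e) d * inner ℝ (a - e) d < (0 : ℝ)
    · set x : ℝ := inner ℝ (q1 - e) d with hx
      set y : ℝ := inner ℝ (a - e) d with hy
      have hxy : (y - x) ≠ 0 := by
        intro h
        have : y = x := by linarith
        rw [this] at hneg
        nlinarith [mul_self_nonneg x]
      have hmem : a + (y / (y - x)) • (q1 - a) ∈ segment ℝ a q1 := by
        rw [segment_eq_image']
        refine ⟨y / (y - x), ⟨?_, ?_⟩, rfl⟩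
        · rcases lt_or_gt_of_ne htq with h | h
          · have : 0 < y := by nlinarith
            exact div_nonneg this.le (by linarith)
          · have : y < 0 := by nlinarith
            exact div_nonneg_of_nonpos this.le (by linarith)
        · rcases lt_or_gt_of_ne htq with h | h
          · have : 0 < y := by nlinarith
            rw [div_le_one (by linarith)]; linarith
          · have : y < 0 := by nlinarith
            rw [div_le_one_of_neg (by linarith)]; linarith
      refine ⟨_, hmem, ?_⟩
      have h0 : inner ℝ (a + (y / (y - x)) • (q1 - a) - e) d = (0 : ℝ) := by
        have : a + (y / (y - x)) • (q1 - a) - e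
          = (a - e) + (y / (y - x)) • ((q1 - e) - (a - e)) := by module
        rw [this, inner_add_left, real_inner_smul_left, inner_sub_left (q1 - e) (a - e), ← hx, ← hy]
        field_simp
        ring
      have := hstrip _ hmem
      rw [h0] at this
      exact abs_le_of_sq_le_sq' (by linarith) hc |>.2
    · push Not at hneg
      refine ⟨a, left_mem_segment ℝ a q1, ?_⟩
      have hwe : w = e + (tw - te) • d := by rw [hte, htw]; module
      have hv := hvar w hw
      have : w - e = (tw - te) • d := by rw [hwe]; abel
      rw [this, inner_smul_right] at hv
      have h2 := pow_le_pow_left₀ (norm_nonneg _) haw 2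
      rw [hwe, hpyth] at h2
      set x : ℝ := inner ℝ (q1 - e) d with hx
      set y : ℝ := inner ℝ (a - e) d with hy
      set τ := tw - te
      have hτy : τ * y ≤ 0 := by
        by_contra h
        push Not at h
        have hx2 : 0 < x ^ 2 := by positivity
        have h3 : (τ * x) * (x * y) ≤ 0 := mul_nonpos_of_nonpos_of_nonneg hv hneg
        nlinarith
      exact abs_le_of_sq_le_sq' (by nlinarith) hc |>.2
  obtain ⟨a', ha's, ha'⟩ := key
  obtain ⟨q, hqs, h1, h2⟩ := geo e a' q1 L c s hcL hs ha' hqe2 hqe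
  exact ⟨q, (convex_segment a q1).segment_subset ha's (right_mem_segment ℝ a q1) hqs,
    ⟨e, heS, h1⟩, h2⟩

lemma helly_line {X : Type*} [NormedAddCommGroup X] [InnerProductSpace ℝ X]
    {ι : Type*} [Nonempty ι] (K : Set X) (hKc : IsCompact K) (hKv : Convex ℝ K)
    (o d : X) (hd : ‖d‖ = 1) (hKl : ∀ y ∈ K, ∃ t : ℝ, y = o + t • d)
    (C : ι → Set X) (hCc : ∀ i, IsClosed (C i)) (hCv : ∀ i, Convex ℝ (C i))
    (hp : ∀ i j, ∃ p ∈ K, p ∈ C i ∧ p ∈ C j) :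
    ∃ p ∈ K, ∀ i, p ∈ C i := by
  classical
  let φ : ℝ →ᵃ[ℝ] X := AffineMap.lineMap o (o + d)
  have hφ : ∀ t, φ t = o + t • d := by
    intro t
    simp [φ, AffineMap.lineMap_apply, add_comm]
  have hφc : Continuous φ := by
    have : (φ : ℝ → X) = fun t => o + t • d := funext hφ
    rw [this]; fun_prop
  have hiso : Isometry φ := by
    refine Isometry.of_dist_eq fun s t => ?_
    rw [hφ, hφ, dist_eq_norm, dist_eq_norm]
    have : o + s • d - (o + t • d) = (s - t) • d := by module
    rw [this, norm_smul, hd, mul_one]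
  have hcomp : ∀ i, IsCompact (φ ⁻¹' (K ∩ C i)) := fun i =>
    hiso.isClosedEmbedding.isCompact_preimage (hKc.inter_right (hCc i))
  have hconv : ∀ i, Convex ℝ (φ ⁻¹' (K ∩ C i)) := fun i =>
    (hKv.inter (hCv i)).affine_preimage φ
  have key : (⋂ i, φ ⁻¹' (K ∩ C i)).Nonempty := by
    refine Convex.helly_theorem_compact' (𝕜 := ℝ) hconv hcomp ?_
    intro I hI
    have hI2 : I.card ≤ 2 := by simpa using hI
    have : ∃ i j, I ⊆ {i, j} := by
      rcases I.eq_empty_or_nonempty with h | ⟨i, hi⟩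
      · exact ⟨Classical.arbitrary ι, Classical.arbitrary ι, by simp [h]⟩
      · rcases (I.erase i).eq_empty_or_nonempty with h | ⟨j, hj⟩
        · refine ⟨i, i, fun k hk => ?_⟩
          by_contra hne
          have : k ∈ I.erase i := by
            rw [Finset.mem_erase]; exact ⟨by simpa using hne, hk⟩
          rw [h] at this; simp at this
        · refine ⟨i, j, fun k hk => ?_⟩
          have hcard : (I.erase i).card ≤ 1 := by
            rw [Finset.card_erase_of_mem hi]; omega
          by_cases hki : k = i
          · simp [hki]
          · have := Finset.card_le_one.1 hcard k (Finset.mem_erase.2 ⟨hki, hk⟩) j hj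
            simp [this]
    obtain ⟨i, j, hij⟩ := this
    obtain ⟨p, hpK, hpi, hpj⟩ := hp i j
    obtain ⟨t, ht⟩ := hKl p hpK
    rw [← hφ] at ht
    subst ht
    refine ⟨t, ?_⟩
    simp only [Set.mem_iInter]
    intro k hk
    have := hij hk
    simp only [Finset.mem_insert, Finset.mem_singleton] at this
    rcases this with rfl | rfl
    · exact ⟨hpK, hpi⟩
    · exact ⟨hpK, hpj⟩
  obtain ⟨t, ht⟩ := key
  rw [Set.mem_iInter] at ht
  exact ⟨φ t, (ht (Classical.arbitrary ι)).1, fun i => (ht i).2⟩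

lemma helly_line' {X : Type*} [NormedAddCommGroup X] [InnerProductSpace ℝ X]
    {ι : Type*} [Nonempty ι] (K : Set X) (hKc : IsCompact K) (hKv : Convex ℝ K)
    (o d : X) (hd : ‖d‖ = 1) (hKl : ∀ y ∈ K, ∃ t : ℝ, y = o + t • d)
    (C : ι → Set X) (hCc : ∀ i, IsClosed (C i)) (hCv : ∀ i, Convex ℝ (C i))
    (hp : ∀ i j, ∃ p ∈ K, p ∈ C i ∧ p ∈ C j)
    (N : Set X) (hNc : IsClosed N) (hNv : Convex ℝ N) (hN : ∀ i, ∃ p ∈ K, p ∈ C i ∧ p ∈ N) :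
    ∃ p ∈ K, p ∈ N ∧ ∀ i, p ∈ C i := by
  obtain ⟨p, hpK, h⟩ := helly_line (ι := Option ι) K hKc hKv o d hd hKl
    (fun i => i.elim N C) (by rintro (_ | i); exacts [hNc, hCc i])
    (by rintro (_ | i); exacts [hNv, hCv i]) (by
      rintro (_ | i) (_ | j)
      · obtain ⟨p, h1, _, h3⟩ := hN (Classical.arbitrary ι)
        exact ⟨p, h1, h3, h3⟩
      · obtain ⟨p, h1, h2, h3⟩ := hN j
        exact ⟨p, h1, h3, h2⟩
      · exact hN i
      · exact hp i j)
  exact ⟨p, hpK, h none, fun i => h (some i)⟩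

lemma closed_add_cb {X : Type*} [NormedAddCommGroup X] {A : Set X} (hA : IsCompact A) (r : ℝ) :
    IsClosed (A + closedBall (0 : X) r) := isClosed_closedBall.add_left_of_isCompact hA

lemma convex_add_cb {X : Type*} [NormedAddCommGroup X] [NormedSpace ℝ X] {A : Set X}
    (hA : Convex ℝ A) (r : ℝ) :
    Convex ℝ (A + closedBall (0 : X) r) := hA.add (convex_closedBall _ _)

lemma hausDistB_le {X : Type*} [NormedAddCommGroup X] (A B : Set X) (R : ℝ) (hR : 0 ≤ R)
    (h1 : ∀ p ∈ A, ∃ q ∈ B, ‖p - q‖ ≤ R) (h2 : ∀ p ∈ B, ∃ q ∈ A, ‖p - q‖ ≤ R) :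
    hausDistB A B ≤ R := by
  refine le_of_forall_pos_le_add fun ε hε => ?_
  refine csInf_le ⟨0, fun r hr => hr.1.le⟩ ⟨by linarith, fun p hp => ?_, fun p hp => ?_⟩
  · obtain ⟨q, hq, h⟩ := h1 p hp
    exact (mem_add_cb _ _ _).2 ⟨q, hq, by linarith⟩
  · obtain ⟨q, hq, h⟩ := h2 p hp
    exact (mem_add_cb _ _ _).2 ⟨q, hq, by linarith⟩

theorem core_line_segments_euclidean
    {M : Type*} (ρ : M → M → ℝ)
    (hρ_refl : ∀ x, ρ x x = 0)
    (hρ_symm : ∀ x y, ρ x y = ρ y x)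
    (hρ_tri : ∀ x y z, ρ x z ≤ ρ x y + ρ y z)
    {X : Type*} [NormedAddCommGroup X] [InnerProductSpace ℝ X]
    (hdim : 1 < Module.rank ℝ X)
    (F : M → Set X)
    (hFne : ∀ x, (F x).Nonempty)
    (hFcp : ∀ x, IsCompact (F x))
    (hFcv : ∀ x, Convex ℝ (F x))
    -- every set `F x` has dimension at most 1: it lies on a line
    (hFdim : ∀ x, ∃ a d : X, ∀ y ∈ F x, ∃ t : ℝ, y = a + t • d)
    -- finiteness hypothesis: selections on subsets of at most 4 points
    (hfin : ∀ M' : Finset M, M'.card ≤ 4 →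
      ∃ f : M → X, (∀ x ∈ M', f x ∈ F x) ∧
        ∀ x ∈ M', ∀ y ∈ M', ‖f x - f y‖ ≤ ρ x y)
    (lam1 lam2 γ : ℝ) (hlam1 : 1 ≤ lam1) (hlam2 : 3 * lam1 ≤ lam2)
    (hγ : lam2 + 2 * lam2 ^ 2 / Real.sqrt (lam2 ^ 2 - lam1 ^ 2) ≤ γ)
    -- the first and second balanced refinements of `F`
    (F1 F2 : M → Set X)
    (hF1 : ∀ x, F1 x = ⋂ z, F z + closedBall (0 : X) (lam1 * ρ x z))
    (hF2 : ∀ x, F2 x = ⋂ z, F1 z + closedBall (0 : X) (lam2 * ρ x z)) :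
    (∀ x, (F2 x).Nonempty) ∧ ∀ x y, hausDistB (F2 x) (F2 y) ≤ γ * ρ x y := by
  classical
  have hρ0 : ∀ x y, 0 ≤ ρ x y := by
    intro x y
    have := hρ_tri x y x
    rw [hρ_refl, hρ_symm y x] at this
    linarith
  have hlam1' : 0 ≤ lam1 := by linarith
  have hlam2' : 0 < lam2 := by linarith
  have hll : lam1 < lam2 := by linarith
  -- lines with unit direction
  have hline : ∀ x, ∃ o d : X, ‖d‖ = 1 ∧ ∀ y ∈ F x, ∃ t : ℝ, y = o + t • d := by
    intro x
    obtain ⟨a, d, h⟩ := hFdim x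
    by_cases hd : d = 0
    · have : Nontrivial X := by
        rcases subsingleton_or_nontrivial X with hs | hn
        · rw [rank_subsingleton'] at hdim
          exact absurd hdim (by simp)
        · exact hn
      obtain ⟨d', hd'⟩ := exists_norm_eq X zero_le_one
      refine ⟨a, d', hd', fun y hy => ⟨0, ?_⟩⟩
      obtain ⟨t, ht⟩ := h y hy
      rw [ht, hd]; simp
    · have hn : ‖d‖ ≠ 0 := norm_ne_zero_iff.2 hd
      refine ⟨a, ‖d‖⁻¹ • d, ?_, fun y hy => ?_⟩
      · rw [norm_smul, norm_inv, norm_norm, inv_mul_cancel₀ hn]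
      · obtain ⟨t, ht⟩ := h y hy
        refine ⟨t * ‖d‖, ?_⟩
        rw [ht, smul_smul, mul_assoc, mul_inv_cancel₀ hn, mul_one]
  choose o d hd hl using hline
  have mF1 : ∀ x p, p ∈ F1 x ↔ ∀ z, p ∈ F z + closedBall (0 : X) (lam1 * ρ x z) := by
    intro x p; rw [hF1, Set.mem_iInter]
  have mF2 : ∀ x p, p ∈ F2 x ↔ ∀ z, p ∈ F1 z + closedBall (0 : X) (lam2 * ρ x z) := by
    intro x p; rw [hF2, Set.mem_iInter]
  have hsub : ∀ x, F1 x ⊆ F x := by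
    intro x p hp
    have := (mF1 x p).1 hp x
    rw [hρ_refl, mul_zero, mem_add_cb] at this
    obtain ⟨a, ha, h⟩ := this
    have : p = a := sub_eq_zero.1 (norm_le_zero_iff.1 h)
    rwa [this]
  have hG_closed : ∀ x, IsClosed (F1 x) := by
    intro x; rw [hF1]
    exact isClosed_iInter fun z => closed_add_cb (hFcp z) _
  have hG_comp : ∀ x, IsCompact (F1 x) := fun x =>
    (hFcp x).of_isClosed_subset (hG_closed x) (hsub x)
  have hG_conv : ∀ x, Convex ℝ (F1 x) := by
    intro x; rw [hF1]
    exact convex_iInter fun z => convex_add_cb (hFcv z) _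
  -- three points
  have hle1 : ∀ x z, ρ x z ≤ lam1 * ρ x z := fun x z => by nlinarith [hρ0 x z]
  have h3 : ∀ x z z', ∃ p ∈ F x, p ∈ F z + closedBall (0 : X) (lam1 * ρ x z) ∧
      p ∈ F z' + closedBall (0 : X) (lam1 * ρ x z') := by
    intro x z z'
    obtain ⟨f, hf, hL⟩ := hfin {x, z, z'} (Finset.card_le_three.trans (by norm_num))
    refine ⟨f x, hf x (by simp), (mem_add_cb _ _ _).2 ⟨f z, hf z (by simp), ?_⟩,
      (mem_add_cb _ _ _).2 ⟨f z', hf z' (by simp), ?_⟩⟩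
    · exact (hL x (by simp) z (by simp)).trans (hle1 x z)
    · exact (hL x (by simp) z' (by simp)).trans (hle1 x z')
  have hpair : ∀ x z, ∃ p ∈ F1 x, ∃ q ∈ F1 z, ‖p - q‖ ≤ ρ x z := by
    intro x z
    have : Nonempty M := ⟨x⟩
    have s1 : ∀ u, ∃ q ∈ F z, q ∈ (F x ∩ (F u + closedBall (0 : X) (lam1 * ρ x u)))
        + closedBall (0 : X) (ρ x z) ∧ ∀ v, q ∈ F v + closedBall (0 : X) (lam1 * ρ z v) := by
      intro u
      refine helly_line' (F z) (hFcp z) (hFcv z) (o z) (d z) (hd z) (hl z)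
        (fun v => F v + closedBall (0 : X) (lam1 * ρ z v)) (fun v => closed_add_cb (hFcp v) _)
        (fun v => convex_add_cb (hFcv v) _) (fun v v' => h3 z v v') _
        (closed_add_cb ((hFcp x).inter_right (closed_add_cb (hFcp u) _)) _)
        (convex_add_cb ((hFcv x).inter (convex_add_cb (hFcv u) _)) _) ?_
      intro v
      obtain ⟨f, hf, hL⟩ := hfin {x, z, u, v} Finset.card_le_four
      refine ⟨f z, hf z (by simp), (mem_add_cb _ _ _).2 ⟨f v, hf v (by simp),
        (hL z (by simp) v (by simp)).trans (hle1 z v)⟩, (mem_add_cb _ _ _).2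
        ⟨f x, ⟨hf x (by simp), (mem_add_cb _ _ _).2 ⟨f u, hf u (by simp),
        (hL x (by simp) u (by simp)).trans (hle1 x u)⟩⟩, ?_⟩⟩
      rw [hρ_symm]
      exact hL z (by simp) x (by simp)
    obtain ⟨p, hpF, hpN, hp⟩ := helly_line' (F x) (hFcp x) (hFcv x) (o x) (d x) (hd x) (hl x)
      (fun v => F v + closedBall (0 : X) (lam1 * ρ x v)) (fun v => closed_add_cb (hFcp v) _)
      (fun v => convex_add_cb (hFcv v) _) (fun v v' => h3 x v v')
      (F1 z + closedBall (0 : X) (ρ x z)) (closed_add_cb (hG_comp z) _)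
      (convex_add_cb (hG_conv z) _) (by
        intro u
        obtain ⟨q, hqF, hqN, hq⟩ := s1 u
        rw [mem_add_cb] at hqN
        obtain ⟨p, ⟨hp1, hp2⟩, hpq⟩ := hqN
        rw [norm_sub_rev] at hpq
        exact ⟨p, hp1, hp2, (mem_add_cb _ _ _).2 ⟨q, (mF1 z q).2 hq, hpq⟩⟩)
    rw [mem_add_cb] at hpN
    exact ⟨p, (mF1 x p).2 hp, hpN⟩
  have hpair2 : ∀ x z z', ∃ p ∈ F x, p ∈ F1 z + closedBall (0 : X) (lam2 * ρ x z) ∧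
      p ∈ F1 z' + closedBall (0 : X) (lam2 * ρ x z') := by
    intro x
    have main : ∀ z z', ρ x z ≤ ρ x z' →
        ∃ p ∈ F x, p ∈ F1 z + closedBall (0 : X) (lam2 * ρ x z) ∧
        p ∈ F1 z' + closedBall (0 : X) (lam2 * ρ x z') := by
      intro z z' hzz
      obtain ⟨q, hq, q', hq', hqq⟩ := hpair z z'
      have := (mF1 z q).1 hq x
      rw [mem_add_cb, hρ_symm z x] at this
      obtain ⟨p, hp, hqp⟩ := this
      rw [norm_sub_rev] at hqp
      refine ⟨p, hp, (mem_add_cb _ _ _).2 ⟨q, hq, ?_⟩, (mem_add_cb _ _ _).2 ⟨q', hq', ?_⟩⟩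
      · nlinarith [hρ0 x z]
      · have t1 : ‖p - q'‖ ≤ ‖p - q‖ + ‖q - q'‖ := norm_sub_le_norm_sub_add_norm_sub _ _ _
        have t2 := hρ_tri z x z'
        rw [hρ_symm z x] at t2
        have t3 : 3 * lam1 * ρ x z' ≤ lam2 * ρ x z' := mul_le_mul_of_nonneg_right hlam2 (hρ0 _ _)
        have t4 : lam1 * ρ x z ≤ lam1 * ρ x z' := mul_le_mul_of_nonneg_left hzz hlam1'
        have t5 := hle1 x z'
        linarith
    intro z z'
    rcases le_total (ρ x z) (ρ x z') with h | h
    · exact main z z' h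
    · obtain ⟨p, h1, h2, h3⟩ := main z' z h
      exact ⟨p, h1, h3, h2⟩
  have hne : ∀ x, (F2 x).Nonempty := by
    intro x
    have : Nonempty M := ⟨x⟩
    obtain ⟨p, _, hp⟩ := helly_line (F x) (hFcp x) (hFcv x) (o x) (d x) (hd x) (hl x)
      (fun z => F1 z + closedBall (0 : X) (lam2 * ρ x z)) (fun z => closed_add_cb (hG_comp z) _)
      (fun z => convex_add_cb (hG_conv z) _) (hpair2 x)
    exact ⟨p, (mF2 x p).2 hp⟩
  have hD : 0 < lam2 ^ 2 - lam1 ^ 2 := by nlinarith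
  have hsD : 0 < Real.sqrt (lam2 ^ 2 - lam1 ^ 2) := Real.sqrt_pos.2 hD
  have hκ : 0 ≤ 2 * lam2 ^ 2 / Real.sqrt (lam2 ^ 2 - lam1 ^ 2) := by positivity
  have hmain : ∀ x y, ∀ p ∈ F2 x, ∃ q ∈ F2 y, ‖p - q‖ ≤ γ * ρ x y := by
    intro x y p hp
    have : Nonempty M := ⟨x⟩
    have hp' := (mF2 x p).1 hp
    obtain ⟨q1, hq1, hpq1⟩ := (mem_add_cb _ _ _).1 (hp' y)
    have claim : ∀ z, ∃ q ∈ F y, q ∈ F1 z + closedBall (0 : X) (lam2 * ρ y z) ∧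
        q ∈ closedBall p (γ * ρ x y) := by
      intro z
      have suff : ∃ q ∈ F y, q ∈ F1 z + closedBall (0 : X) (lam2 * ρ y z) ∧
          ‖q1 - q‖ ≤ 2 * lam2 ^ 2 / Real.sqrt (lam2 ^ 2 - lam1 ^ 2) * ρ x y := by
        by_cases hcase : q1 ∈ F1 z + closedBall (0 : X) (lam2 * ρ y z)
        · refine ⟨q1, hsub y hq1, hcase, ?_⟩
          rw [sub_self, norm_zero]
          exact mul_nonneg hκ (hρ0 _ _)
        · have hfar : ∀ w ∈ F1 z, lam2 * ρ y z < ‖q1 - w‖ := by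
            intro w hw
            by_contra h
            push Not at h
            exact hcase ((mem_add_cb _ _ _).2 ⟨w, hw, h⟩)
          have hr : 0 < ρ y z := by
            rcases (hρ0 y z).eq_or_lt with h | h
            · exfalso
              apply hcase
              refine (mem_add_cb _ _ _).2 ⟨q1, ?_, by rw [← h]; simp⟩
              rw [mF1]
              intro w
              have e : ρ z w = ρ y w := by
                have := hρ_tri z y w
                have := hρ_tri y z w
                have := hρ_symm z y
                linarith
              rw [e]
              exact (mF1 y q1).1 hq1 w
            · exact h
          obtain ⟨a, ha, w, hw, haw⟩ := hpair y z
          obtain ⟨w', hw', hpw'⟩ := (mem_add_cb _ _ _).1 (hp' z)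
          obtain ⟨q, hqs, hqS, hqq⟩ := geo2 (F1 z) (hG_comp z) (hG_conv z) (o z) (d z) (hd z)
            (fun v hv => hl z v (hsub z hv)) a q1 (lam2 * ρ y z) (lam1 * ρ y z)
            (2 * lam2 * ρ x y) (mul_lt_mul_of_pos_right hll hr)
            (mul_nonneg (by linarith) (hρ0 _ _)) ⟨w, hw, haw.trans (hle1 y z)⟩
            (by
              intro v hv
              have hv' := (hG_conv y).segment_subset ha hq1 hv
              obtain ⟨g, hg, hvg⟩ := (mem_add_cb _ _ _).1 ((mF1 y v).1 hv' z)
              obtain ⟨t, ht⟩ := hl z g hg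
              exact ⟨t, by rwa [← ht]⟩)
            ⟨w', hw', by
              have t1 : ‖q1 - w'‖ ≤ ‖q1 - p‖ + ‖p - w'‖ := norm_sub_le_norm_sub_add_norm_sub _ _ _
              rw [norm_sub_rev q1 p] at t1
              have t2 := hρ_tri x y z
              nlinarith⟩ hfar
          refine ⟨q, (hFcv y).segment_subset (hsub y ha) (hsub y hq1) hqs,
            (mem_add_cb _ _ _).2 hqS, ?_⟩
          have e1 : (lam2 * ρ y z) ^ 2 - (lam1 * ρ y z) ^ 2
            = (ρ y z) ^ 2 * (lam2 ^ 2 - lam1 ^ 2) := by ring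
          rw [e1, Real.sqrt_mul (sq_nonneg _), Real.sqrt_sq hr.le] at hqq
          rw [div_mul_eq_mul_div, le_div_iff₀ hsD]
          have : ρ y z * (‖q1 - q‖ * Real.sqrt (lam2 ^ 2 - lam1 ^ 2))
            ≤ ρ y z * (2 * lam2 ^ 2 * ρ x y) := by linarith
          exact le_of_mul_le_mul_left this hr
      obtain ⟨q, h1, h2, h3⟩ := suff
      refine ⟨q, h1, h2, ?_⟩
      rw [mem_closedBall, dist_eq_norm, norm_sub_rev]
      have t1 : ‖p - q‖ ≤ ‖p - q1‖ + ‖q1 - q‖ := norm_sub_le_norm_sub_add_norm_sub _ _ _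
      have t2 := mul_le_mul_of_nonneg_right hγ (hρ0 x y)
      linarith
    obtain ⟨q, _, hqN, hq⟩ := helly_line' (F y) (hFcp y) (hFcv y) (o y) (d y) (hd y) (hl y)
      (fun z => F1 z + closedBall (0 : X) (lam2 * ρ y z)) (fun z => closed_add_cb (hG_comp z) _)
      (fun z => convex_add_cb (hG_conv z) _) (hpair2 y) (closedBall p (γ * ρ x y))
      isClosed_closedBall (convex_closedBall _ _) claim
    refine ⟨q, (mF2 y q).2 hq, ?_⟩
    rwa [mem_closedBall, dist_eq_norm, norm_sub_rev] at hqN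
  refine ⟨hne, fun x y => hausDistB_le _ _ _ (mul_nonneg (by linarith) (hρ0 _ _)) (hmain x y) ?_⟩
  rw [hρ_symm x y]
  exact hmain y x
end
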